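/- arXiv:2404.17921 — 4 statements merged into one kernel-verified Lean document; each statement's English description precedes it below -/
import Mathlib

section
/- Let a, b ∈ ℤ. The polynomial F(x) = x⁸ + a·x⁴ + b is monogenic with Galois group Gal(F) isomorphic to the dihedral group of order 16 if and only if a = 0 and b = 2 (i.e., F(x) = x⁸ + 2). -/
open Polynomial

/-- A monic polynomial `f ∈ ℤ[x]` is *monogenic* if it is irreducible over `ℚ` and,
for any number field `K` generated over `ℚ` by a root `θ` of `f`, the ring `ℤ[θ]`
is the full ring of integers (the integral closure of `ℤ`) of `K`. -/
def IsMonogenic (f : Polynomial ℤ) : Prop :=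
  f.Monic ∧ Irreducible (f.map (Int.castRingHom ℚ)) ∧
    ∀ (K : Type) [Field K] [NumberField K] (θ : K),
      Polynomial.aeval θ f = 0 →
      Algebra.adjoin ℚ {θ} = (⊤ : Subalgebra ℚ K) →
      Algebra.adjoin ℤ {θ} = integralClosure ℤ K

theorem eq_zero_of_aeval_eq_zero_of_degree_lt {K : Type*} [Field K] [CharZero K] {f P : ℤ[X]}
    (hm : f.Monic) (hi : Irreducible (f.map (Int.castRingHom ℚ))) {θ : K}
    (hθ : aeval θ f = 0) (hP : P.degree < f.degree) (h : aeval θ P = 0) : P = 0 := by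
  have hq : ∀ g : ℤ[X], aeval θ (g.map (Int.castRingHom ℚ)) = aeval θ g := fun g =>
    aeval_map_algebraMap (A := ℚ) θ g
  have hmin := minpoly.eq_of_irreducible_of_monic hi ((hq f).trans hθ) (hm.map _)
  have hdvd := minpoly.dvd ℚ θ ((hq P).trans h)
  rw [← hmin] at hdvd
  have hinj : Function.Injective (Int.castRingHom ℚ) := Int.cast_injective
  refine (Polynomial.map_eq_zero_iff hinj).1 (eq_zero_of_dvd_of_degree_lt hdvd ?_)
  rwa [degree_map_eq_of_injective hinj, degree_map_eq_of_injective hinj]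

theorem IsMonogenic.dvd_coeff {f : ℤ[X]} (hf : IsMonogenic f) {K : Type} [Field K] [NumberField K]
    {θ : K} (hroot : aeval θ f = 0) (hgen : Algebra.adjoin ℚ {θ} = (⊤ : Subalgebra ℚ K))
    {u : K} {n : ℤ} {P : ℤ[X]} (hP : P.degree < f.degree) (hu : IsIntegral ℤ u)
    (h : n * u = aeval θ P) (k : ℕ) : n ∣ P.coeff k := by
  obtain ⟨hm, hi, hmono⟩ := hf
  have hmem : u ∈ Algebra.adjoin ℤ {θ} := by
    rw [hmono _ _ hroot hgen]
    exact hu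
  rw [Algebra.adjoin_singleton_eq_range_aeval] at hmem
  obtain ⟨Q, hQ⟩ := hmem
  have hQ' : aeval θ (Q %ₘ f) = u := by
    rw [← hQ, aeval_modByMonic_eq_self_of_root hroot]; rfl
  have := eq_zero_of_aeval_eq_zero_of_degree_lt (P := C n * (Q %ₘ f) - P) hm hi hroot
    ((degree_sub_le _ _).trans_lt (max_lt ?_ hP)) ?_
  · rw [← sub_eq_zero.1 this, coeff_C_mul]
    exact dvd_mul_right _ _
  · rw [← smul_eq_C_mul]
    exact (degree_smul_le _ _).trans_lt (degree_modByMonic_lt _ hm)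
  · rw [map_sub, map_mul, hQ', ← h]; simp

theorem exists_numberField_root {f : ℤ[X]} (hi : Irreducible (f.map (Int.castRingHom ℚ))) :
    ∃ (K : Type) (_ : Field K) (_ : NumberField K) (θ : K), aeval θ f = 0 ∧
      Algebra.adjoin ℚ {θ} = (⊤ : Subalgebra ℚ K) := by
  obtain ⟨K, _, A, hfin, θ, hroot, hgen⟩ : ∃ (K : Type) (_ : Field K) (_ : Algebra ℚ K)
      (_ : FiniteDimensional ℚ K) (θ : K), aeval θ (f.map (Int.castRingHom ℚ)) = 0 ∧
      Algebra.adjoin ℚ {θ} = (⊤ : Subalgebra ℚ K) := by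
    have := Fact.mk hi
    exact ⟨AdjoinRoot (f.map (Int.castRingHom ℚ)), inferInstance, inferInstance,
      (AdjoinRoot.powerBasis hi.ne_zero).finite, AdjoinRoot.root _,
      (AdjoinRoot.aeval_eq _).trans AdjoinRoot.mk_self, AdjoinRoot.adjoinRoot_eq_top⟩
  have hchar : CharZero K := algebraRat.charZero K
  obtain rfl : A = DivisionRing.toRatAlgebra := Subsingleton.elim _ _
  exact ⟨K, inferInstance, ⟨⟩, θ, (aeval_map_algebraMap (A := ℚ) θ f).symm.trans hroot, hgen⟩

theorem exists_of_dihedral_relations {k L : Type*} [Field k] [Field L] [Algebra k L]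
    (r s : L ≃ₐ[k] L) (hfix : ∀ x, r x = x → s x = x → ∃ q : k, algebraMap k L q = x)
    {θ φ ι : L} {a b : k}
    (hθ : θ ≠ 0) (hφ : φ ≠ 0) (hι : ι ^ 2 = -1)
    (hsum : θ ^ 4 + φ ^ 4 = - algebraMap k L a) (hprod : θ ^ 4 * φ ^ 4 = algebraMap k L b)
    (hrθ : r θ = φ) (hrφ : r φ = ι * θ) (hsθ : s θ = θ) (hss : s (s φ) = φ) (hrs : r (s φ) = θ) :
    (∃ t : k, t ^ 4 = -4 * b) ∨
      (∃ q : k, q ^ 2 = -(b * (a ^ 2 - 4 * b))) ∧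
        (a * (a ^ 2 - 3 * b) = 0 → ∃ t : k, t ^ 2 = 2 ∨ t ^ 2 = 2 * b) := by
  have hinj := (algebraMap k L).injective
  have hpm : ∀ x : L, x ^ 2 = -1 → x = ι ∨ x = -ι := fun x hx => by
    rw [← sq_eq_sq_iff_eq_or_eq_neg, hx, hι]
  rcases hpm (r ι) (by rw [← map_pow, hι]; simp) with hr | hr
  · right
    have hsφ : s φ = -(ι * φ) := r.injective (by
      rw [hrs, map_neg, map_mul, hr, hrφ]; linear_combination θ * hι)
    have hsι : s ι = -ι := by
      have : s (s φ) = - (s ι * s φ) := by rw [hsφ]; simp [hsφ]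
      rw [hss, hsφ] at this
      have h : φ * (s ι * ι - 1) = 0 := by linear_combination -this
      have h := (mul_eq_zero.1 h).resolve_left hφ
      linear_combination (-ι) * h + s ι * hι
    constructor
    · obtain ⟨q, hq⟩ := hfix (ι * (θ * φ) ^ 2 * (θ ^ 4 - φ ^ 4))
        (by simp only [map_mul, map_sub, map_pow, hr, hrθ, hrφ]
            linear_combination (-ι * θ^2*φ^2 *θ^4 *(ι^4 - ι^2 + 1) +ι * θ^2*φ^2*φ^4) * hι)
        (by simp only [map_mul, map_sub, map_pow, hsι, hsθ, hsφ]
            linear_combination (-ι * θ^2*φ^2 *θ^4 + ι * θ^2*φ^2 *φ^4 *(ι^4 - ι^2 + 1)) * hι)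
      refine ⟨q, hinj ?_⟩
      simp only [map_mul, map_sub, map_pow, map_neg, hq]
      rw [← hprod, show algebraMap k L a = -(θ^4 + φ^4) by rw [hsum]; simp]
      simp only [map_ofNat]
      linear_combination (θ^4*φ^4*(θ^4-φ^4)^2)*hι
    · intro hab
      have hab' : θ ^ 12 + φ ^ 12 = 0 := by
        have h1 : -algebraMap k L (a * (a ^ 2 - 3 * b)) = 0 := by simp [hab]
        simp only [map_mul, map_sub, map_pow, map_ofNat] at h1
        rw [← hprod, show algebraMap k L a = -(θ^4 + φ^4) by rw [hsum]; simp] at h1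
        linear_combination h1
      obtain ⟨η, hη⟩ : ∃ η : L, η = φ ^ 3 / θ ^ 3 := ⟨_, rfl⟩
      have hη0 : η ≠ 0 := by rw [hη]; positivity
      have hη4 : η ^ 4 = -1 := by
        rw [hη]; field_simp; linear_combination hab'
      have hrη : r η * η = -ι := by
        rw [hη]; simp only [map_div₀, map_pow, hrθ, hrφ]; field_simp
        linear_combination ι * hι
      have hsη : s η = ι * η := by
        rw [hη]; simp only [map_div₀, map_pow, hsθ, hsφ]; field_simp
        linear_combination -ι * hι
      have ht : (η - η ^ 3) ^ 2 = 2 := by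
        linear_combination (-2 + η ^ 2) * hη4
      rcases hpm (η ^ 2) (by rw [← hη4]; ring) with h | h
      · have h1 : r η = -η := mul_right_cancel₀ hη0 (by rw [hrη, ← h]; ring)
        rw [← h] at hsη
        obtain ⟨q, hq⟩ := hfix ((η - η ^ 3) * (θ * φ) ^ 2)
          (by simp only [map_mul, map_sub, map_pow, hrθ, hrφ, h1]
              linear_combination (-(η - η^3) * θ^2*φ^2)* hι)
          (by simp only [map_mul, map_sub, map_pow, hsθ, hsφ, hsη]
              linear_combination ((η^3 - η^9) * θ^2*φ^2)* hι + (η * θ^2*φ^2*(η^4-1))*hη4)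
        refine ⟨q, Or.inr (hinj ?_)⟩
        simp only [map_mul, map_pow, hq, map_ofNat]
        rw [← hprod, ← ht]; ring
      · have h1 : r η = η := mul_right_cancel₀ hη0 (by rw [hrη, ← h]; ring)
        rw [show ι = - η ^ 2 by rw [h]; ring] at hsη
        obtain ⟨q, hq⟩ := hfix (η - η ^ 3)
          (by simp only [map_sub, map_pow, h1])
          (by simp only [map_sub, map_pow, hsη]
              linear_combination (η ^ 5 - η)*hη4)
        refine ⟨q, Or.inl (hinj ?_)⟩
        simp only [map_pow, hq, map_ofNat, ht]
  · left
    have hsφ : s φ = ι * φ := r.injective (by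
      rw [hrs, map_mul, hr, hrφ]; linear_combination θ * hι)
    have hsι : s ι = -ι := by
      have : s (s φ) = s ι * s φ := by rw [hsφ]; simp [hsφ]
      rw [hss, hsφ] at this
      have h : φ * (s ι * ι - 1) = 0 := by linear_combination -this
      have h := (mul_eq_zero.1 h).resolve_left hφ
      linear_combination (-ι) * h + s ι * hι
    obtain ⟨q, hq⟩ := hfix ((1 + ι) * (θ * φ))
        (by simp only [map_mul, map_add, map_one, hr, hrθ, hrφ]
            linear_combination (- θ*φ) * hι)
        (by simp only [map_mul, map_add, map_one, hsι, hsθ, hsφ]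
            linear_combination (- θ*φ) * hι)
    refine ⟨q, hinj ?_⟩
    simp only [map_mul, map_pow, map_neg, map_ofNat, hq]
    rw [← hprod]
    linear_combination (θ^4*φ^4*(ι^2 + 4 * ι + 5)) * hι

theorem degree_octic (a b : ℤ) : (X ^ 8 + C a * X ^ 4 + C b : ℤ[X]).degree = 8 := by
  compute_degree!

theorem squarefree_of_isMonogenic_octic {a b : ℤ}
    (hf : IsMonogenic (X ^ 8 + C a * X ^ 4 + C b)) : Squarefree b := by
  obtain ⟨K, _, _, θ, hroot, hgen⟩ := exists_numberField_root hf.2.1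
  have hind := fun P => eq_zero_of_aeval_eq_zero_of_degree_lt (P := P) hf.1 hf.2.1 hroot
  rw [degree_octic] at hind
  have hθ0 : θ ≠ 0 := fun h => X_ne_zero (R := ℤ) (hind X (by rw [degree_X]; norm_num) (by simpa))
  have heq : θ ^ 8 + a * θ ^ 4 + b = 0 := by simpa using hroot
  have hb : b ≠ 0 := by
    rintro rfl
    have h0 : θ ^ 4 * (θ ^ 4 + a) = 0 := by rw [← heq]; push_cast; ring
    have := hind (X ^ 4 + C a) (by rw [degree_X_pow_add_C (by norm_num)]; norm_num)
      (by simpa using (mul_eq_zero.1 h0).resolve_left (pow_ne_zero _ hθ0))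
    exact X_pow_add_C_ne_zero (by norm_num) a this
  rintro p ⟨c, hc⟩
  have hp : (p : K) ≠ 0 := by
    rintro h
    have : p = 0 := by exact_mod_cast h
    simp [this] at hc
    exact hb hc
  have hcb : (b : K) = p * p * c := by rw [hc]; push_cast; ring
  let u : K := θ ^ 3 * (θ ^ 4 + a) / p
  have huθ : u * θ = -(p * c) := by
    simp only [u]; field_simp
    linear_combination heq - hcb
  have hu : u ^ 8 + (a * p ^ 2 * c ^ 3) * u ^ 4 + p ^ 6 * c ^ 7 = 0 := by
    have h4 : u ^ 4 * θ ^ 4 = (p * c) ^ 4 := by rw [← mul_pow, huθ]; ring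
    refine (mul_eq_zero.1 ?_).resolve_right (pow_ne_zero 8 hθ0)
    rw [hcb] at heq
    linear_combination (u ^ 4 * θ ^ 4 + (p * c) ^ 4 + a * p ^ 2 * c ^ 3 * θ ^ 4) * h4
      + p ^ 6 * c ^ 7 * heq
  have huint : IsIntegral ℤ u :=
    ⟨X ^ 8 + C (a * p ^ 2 * c ^ 3) * X ^ 4 + C (p ^ 6 * c ^ 7), by monicity!,
      by simpa only [eval₂_add, eval₂_mul, eval₂_pow, eval₂_X, eval₂_C, algebraMap_int_eq,
        Int.coe_castRingHom, Int.cast_mul, Int.cast_pow] using hu⟩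
  have := hf.dvd_coeff hroot hgen (u := u) (n := p) (P := X ^ 7 + C a * X ^ 3)
    (by rw [degree_octic]; compute_degree!) huint
    (by simp only [u, map_add, map_mul, map_pow, aeval_X, aeval_C]; field_simp; simp) 7
  simpa [coeff_X_pow, isUnit_iff_dvd_one] using this

theorem eq_zero_or_eq_three_of_isMonogenic_octic {a b q : ℤ}
    (hf : IsMonogenic (X ^ 8 + C a * X ^ 4 + C b)) (hq : q ^ 2 = -(b * (a ^ 2 - 4 * b))) :
    a = 0 ∨ b = 3 ∧ a ^ 2 = 9 := by
  have hsq := squarefree_of_isMonogenic_octic hf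
  obtain ⟨K, _, _, θ, hroot, hgen⟩ := exists_numberField_root hf.2.1
  have hind := fun P => eq_zero_of_aeval_eq_zero_of_degree_lt (P := P) hf.1 hf.2.1 hroot
  rw [degree_octic] at hind
  have heq : θ ^ 8 + a * θ ^ 4 + b = 0 := by simpa using hroot
  have hδ : 2 * θ ^ 4 + a ≠ 0 := fun h => by
    have := hind (C 2 * X ^ 4 + C a) (by compute_degree!) (by
      simpa only [map_add, map_mul, map_pow, aeval_X, aeval_C, algebraMap_int_eq,
        Int.coe_castRingHom, Int.cast_ofNat] using h)
    have := congrArg (coeff · 4) this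
    simp only [coeff_add, coeff_C_mul, coeff_X_pow, coeff_C] at this
    simp at this
  have hδ2 : (2 * θ ^ 4 + a) ^ 2 = ((a ^ 2 - 4 * b : ℤ) : K) := by
    push_cast; linear_combination 4 * heq
  have hd : a ^ 2 - 4 * b ≠ 0 := fun h => by
    rw [h] at hδ2
    exact hδ (by simpa using hδ2)
  have hqK : (q : K) ^ 2 = -(b * ((a ^ 2 - 4 * b : ℤ) : K)) := by exact_mod_cast hq
  have huint : IsIntegral ℤ ((q : K) / (2 * θ ^ 4 + a)) := by
    refine ⟨X ^ 2 + C b, by monicity!, ?_⟩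
    have : ((q : K) / (2 * θ ^ 4 + a)) ^ 2 = -b := by
      field_simp; rw [hqK, hδ2]; ring
    simp only [eval₂_add, eval₂_pow, eval₂_X, eval₂_C, algebraMap_int_eq, Int.coe_castRingHom, this]
    ring
  obtain ⟨n, hn⟩ := hf.dvd_coeff hroot hgen (n := a ^ 2 - 4 * b)
    (P := C (2 * q) * X ^ 4 + C (q * a)) (by rw [degree_octic]; compute_degree!) huint
    (by rw [← hδ2]
        simp only [map_add, map_mul, map_pow, aeval_X, aeval_C, algebraMap_int_eq,
          Int.coe_castRingHom, Int.cast_ofNat]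
        field_simp) 4
  have hn : 2 * q = (a ^ 2 - 4 * b) * n := by
    simpa only [coeff_add, coeff_C_mul, coeff_X_pow, coeff_C, if_true, mul_one, OfNat.ofNat_ne_zero,
      if_false, add_zero] using hn
  have hn2 : (a ^ 2 - 4 * b) * n ^ 2 = -4 * b := by
    refine mul_left_cancel₀ hd ?_
    linear_combination 4 * hq - (2 * q + (a ^ 2 - 4 * b) * n) * hn
  have sq_one : ∀ m c : ℤ, b = m * m * c → m ^ 2 = 1 := fun m c h => by
    have := Int.isUnit_iff.1 (hsq m ⟨c, h⟩)
    rcases this with rfl | rfl <;> rfl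
  rcases Int.even_or_odd' n with ⟨m, rfl | rfl⟩
  · have := sq_one m (-(a ^ 2 - 4 * b)) (by linarith)
    have h3 : a ^ 2 = 3 * b := by
      rw [mul_pow, this] at hn2; linarith
    obtain ⟨e, rfl⟩ : 3 ∣ a := Int.prime_three.dvd_of_dvd_pow ⟨b, h3⟩
    have hb : b = 3 * e ^ 2 := by linarith
    have := sq_one e 3 (by linarith)
    right; constructor <;> nlinarith
  · have h4 : (4 : ℤ) ∣ (a ^ 2 - 4 * b) := by
      have hc : IsCoprime (4 : ℤ) ((2 * m + 1) ^ 2) :=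
        ⟨-(m ^ 2 + m), 1, by ring⟩
      exact hc.dvd_of_dvd_mul_right ⟨-b, by linarith⟩
    obtain ⟨c, hc⟩ := h4
    have := sq_one (2 * m + 1) (-c) (by rw [hc] at hn2; linarith)
    rw [this] at hn2
    left
    have : a ^ 2 = 0 := by linarith
    simpa using this

theorem exists_int_eq_of_pow_eq {t : ℚ} {n : ℕ} (hn : n ≠ 0) {c : ℤ} (h : t ^ n = c) :
    ∃ k : ℤ, (k : ℚ) = t := by
  have : IsIntegral ℤ t := IsIntegral.of_pow (Nat.pos_of_ne_zero hn) (by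
    rw [h]; exact isIntegral_algebraMap (R := ℤ) (A := ℚ) (x := c))
  exact IsIntegrallyClosed.isIntegral_iff.1 this

theorem pow_four_ne_of_squarefree {b : ℤ} (hb : Squarefree b) (t : ℚ) : t ^ 4 ≠ -4 * b := by
  intro h
  obtain ⟨k, rfl⟩ := exists_int_eq_of_pow_eq (n := 4) (c := -4 * b) (by norm_num)
    (by push_cast; exact h)
  have h : k ^ 4 = -4 * b := by exact_mod_cast h
  obtain ⟨m, rfl⟩ : 2 ∣ k := Int.prime_two.dvd_of_dvd_pow (n := 4) ⟨-2 * b, by linarith⟩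
  have := hb 2 ⟨-m ^ 4, by linarith⟩
  rw [Int.isUnit_iff] at this
  omega

theorem eq_two_of_sq_eq {b : ℤ} (hb : Squarefree b) {t : ℚ} (h : t ^ 2 = 2 * b) : b = 2 := by
  obtain ⟨k, rfl⟩ := exists_int_eq_of_pow_eq (n := 2) (c := 2 * b) (by norm_num)
    (by push_cast; exact h)
  have h : k ^ 2 = 2 * b := by exact_mod_cast h
  obtain ⟨m, rfl⟩ : 2 ∣ k := Int.prime_two.dvd_of_dvd_pow (n := 2) ⟨b, h⟩
  rcases Int.isUnit_iff.1 (hb m ⟨2, by linarith⟩) with rfl | rfl <;> linarith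

theorem rat_sq_ne_two (t : ℚ) : t ^ 2 ≠ 2 := by
  intro h
  have := eq_two_of_sq_eq (b := 1) squarefree_one (t := t) (by simpa using h)
  omega

theorem exists_of_gal_equiv_dihedral {k L : Type*} [Field k] [Field L] [Algebra k L]
    [FiniteDimensional k L] [IsGalois k L] (e : (L ≃ₐ[k] L) ≃* DihedralGroup 8) {a b : k}
    (hb : b ≠ 0)
    (hext : ∀ g : L ≃ₐ[k] L,
      (∀ θ : L, θ ^ 8 + algebraMap k L a * θ ^ 4 + algebraMap k L b = 0 → g θ = θ) → g = 1) :
    (∃ t : k, t ^ 4 = -4 * b) ∨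
      (∃ q : k, q ^ 2 = -(b * (a ^ 2 - 4 * b))) ∧
        (a * (a ^ 2 - 3 * b) = 0 → ∃ t : k, t ^ 2 = 2 ∨ t ^ 2 = 2 * b) := by
  obtain ⟨r, hr⟩ : ∃ r, e r = DihedralGroup.r 1 := e.surjective _
  have hr4 : r ^ 4 ≠ 1 := fun h => by
    have := congrArg e h
    rw [map_pow, hr, map_one] at this
    revert this
    decide
  obtain ⟨θ, hθ, hne⟩ : ∃ θ : L, θ ^ 8 + algebraMap k L a * θ ^ 4 + algebraMap k L b = 0 ∧
      (r ^ 4) θ ≠ θ := by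
    by_contra! h
    exact hr4 (hext _ h)
  have hne : r (r (r (r θ))) ≠ θ := hne
  have hroot : ∀ g : L ≃ₐ[k] L,
      g θ ^ 8 + algebraMap k L a * g θ ^ 4 + algebraMap k L b = 0 := fun g => by
    simpa using congrArg g hθ
  have hroot0 : ∀ x : L, x ^ 8 + algebraMap k L a * x ^ 4 + algebraMap k L b = 0 → x ≠ 0 := by
    rintro x hx rfl
    exact hb (by simpa using hx)
  have hθ0 := hroot0 _ hθ
  have hsign : ∀ x : L, x ^ 4 = 1 → r x = x ∨ r x = -x := fun x hx => by
    rw [← sq_eq_sq_iff_eq_or_eq_neg, ← map_pow]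
    rcases sq_eq_one_iff.1 (show (x ^ 2) ^ 2 = 1 by rw [← hx]; ring) with h | h <;>
      simp [h]
  have hrr : ∀ x : L, x ^ 4 = 1 → r (r x) = x := fun x hx => by
    rcases hsign x hx with h | h <;> simp [h]
  obtain ⟨φ, hφ⟩ : ∃ φ, r θ = φ := ⟨_, rfl⟩
  have hφroot := hroot r
  rw [hφ] at hφroot hne
  have hφ0 := hroot0 _ hφroot
  have hsum : θ ^ 4 + φ ^ 4 = - algebraMap k L a := by
    have : (φ ^ 4 - θ ^ 4) * (θ ^ 4 + φ ^ 4 + algebraMap k L a) = 0 := by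
      linear_combination hφroot - hθ
    rcases mul_eq_zero.1 this with h | h
    · exfalso
      obtain ⟨ζ, rfl⟩ : ∃ ζ, φ = ζ * θ := ⟨φ / θ, by field_simp⟩
      have hζ : ζ ^ 4 = 1 := by
        refine mul_right_cancel₀ (pow_ne_zero 4 hθ0) ?_
        linear_combination h
      apply hne
      rcases hsign ζ hζ with h1 | h1 <;> simp [h1, hφ] <;> linear_combination θ * hζ
    · linear_combination h
  have hprod : θ ^ 4 * φ ^ 4 = algebraMap k L b := by
    linear_combination θ ^ 4 * hsum - hθ
  obtain ⟨ι, hι⟩ : ∃ ι, r φ = ι * θ := ⟨r φ / θ, by field_simp⟩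
  have hι4 : ι ^ 4 = 1 := by
    have h := congrArg r hsum
    simp only [map_add, map_pow, hφ, hι, map_neg, AlgEquiv.commutes] at h
    refine mul_right_cancel₀ (pow_ne_zero 4 hθ0) ?_
    linear_combination h - hsum
  have hrrι := hrr ι hι4
  have hι2 : ι ^ 2 = -1 := by
    rcases sq_eq_one_iff.1 (show (ι ^ 2) ^ 2 = 1 by rw [← hι4]; ring) with h | h
    · exfalso
      apply hne
      rw [hι, map_mul, map_mul, hrrι, hφ, hι]
      linear_combination θ * h
    · exact h
  have hpow : ∀ x j ψ : L, j ^ 2 = -1 → r (r x) = j * x → ψ ^ 4 = x ^ 4 →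
      ∃ n : ℕ, (r ^ (2 * n)) x = ψ := by
    intro x j ψ hj hx hψ
    have hj2 := hrr j (by linear_combination (j ^ 2 - 1) * hj)
    have h4 : r (r (r (r x))) = -x := by
      rw [hx, map_mul, map_mul, hj2, hx]; linear_combination x * hj
    have h : (ψ - x) * (ψ - -x) * ((ψ - j * x) * (ψ - -(j * x))) = 0 := by
      linear_combination hψ - (ψ ^ 2 - x ^ 2) * x ^ 2 * hj
    rcases mul_eq_zero.1 h with h | h <;> rcases mul_eq_zero.1 h with h | h <;>
      rw [sub_eq_zero.1 h]
    · exact ⟨0, rfl⟩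
    · exact ⟨2, h4⟩
    · exact ⟨1, hx⟩
    · refine ⟨3, ?_⟩
      change r (r (r (r (r (r x))))) = _
      rw [h4, map_neg, map_neg, hx]
  obtain ⟨n, hn⟩ : ∃ n : ℕ, (r ^ n) θ = e.symm (DihedralGroup.sr 0) θ := by
    have hψ := hroot (e.symm (DihedralGroup.sr 0))
    generalize e.symm (DihedralGroup.sr 0) θ = ψ at hψ
    have h : (ψ ^ 4 - θ ^ 4) * (ψ ^ 4 - φ ^ 4) = 0 := by
      linear_combination hψ - ψ ^ 4 * hsum + hprod
    rcases mul_eq_zero.1 h with h | h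
    · obtain ⟨n, hn⟩ := hpow θ ι ψ hι2 (by rw [hφ, hι]) (sub_eq_zero.1 h)
      exact ⟨_, hn⟩
    · obtain ⟨n, hn⟩ := hpow φ (r ι) ψ (by rw [← map_pow, hι2]; simp) (by rw [hι, map_mul, hφ])
        (sub_eq_zero.1 h)
      exact ⟨2 * n + 1, by rw [pow_succ, AlgEquiv.mul_apply, hφ, hn]⟩
  obtain ⟨s, hs⟩ : ∃ s, e s = DihedralGroup.sr (n : ZMod 8) := e.surjective _
  have hrs : r * s * r = s := e.injective (by simp [hr, hs])
  have hss : s * s = 1 := e.injective (by simp [hs])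
  have hsθ : s θ = θ := by
    have h : r ^ n * s = e.symm (DihedralGroup.sr 0) := e.injective (by simp [hr, hs])
    refine (r ^ n).injective ?_
    rw [← AlgEquiv.mul_apply, h, hn]
  refine exists_of_dihedral_relations r s ?_ hθ0 hφ0 hι2 hsum hprod hφ hι hsθ
    (DFunLike.congr_fun hss φ) ?_
  · intro x hrx hsx
    refine (IsGalois.mem_range_algebraMap_iff_fixed x).2 fun g => ?_
    have hpx : ∀ n : ℕ, (r ^ n) x = x := fun n => by
      induction n with
      | zero => rfl
      | succ n ih => rw [pow_succ, AlgEquiv.mul_apply, hrx, ih]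
    rcases hg : e g with i | i
    · have : g = r ^ i.val := e.injective (by simp [hr, hg])
      rw [this, hpx]
    · have : g = s * r ^ (i - n).val := e.injective (by simp [hr, hs, hg])
      rw [this, AlgEquiv.mul_apply, hpx, hsx]
  · have := DFunLike.congr_fun hrs θ
    rwa [AlgEquiv.mul_apply, AlgEquiv.mul_apply, hφ, hsθ] at this

theorem exists_of_octic_gal_equiv_dihedral {k : Type*} [Field k] {p : k[X]} (hp : p.Separable)
    {a b : k} (hpab : p = X ^ 8 + C a * X ^ 4 + C b) (hb : b ≠ 0) (e : p.Gal ≃* DihedralGroup 8) :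
    (∃ t : k, t ^ 4 = -4 * b) ∨
      (∃ q : k, q ^ 2 = -(b * (a ^ 2 - 4 * b))) ∧
        (a * (a ^ 2 - 3 * b) = 0 → ∃ t : k, t ^ 2 = 2 ∨ t ^ 2 = 2 * b) := by
  have := IsGalois.of_separable_splitting_field (F := k) (E := p.SplittingField) hp
  refine exists_of_gal_equiv_dihedral (L := p.SplittingField) e hb
    fun g hg => Gal.ext p fun x hx => hg x ?_
  rw [mem_rootSet] at hx
  simpa [hpab] using hx.2

theorem eq_zero_and_eq_two_of_isMonogenic {a b : ℤ}
    (hf : IsMonogenic (X ^ 8 + C a * X ^ 4 + C b))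
    (e : ((X ^ 8 + C a * X ^ 4 + C b : ℤ[X]).map (Int.castRingHom ℚ)).Gal ≃* DihedralGroup 8) :
    a = 0 ∧ b = 2 := by
  have hsq := squarefree_of_isMonogenic_octic hf
  have key := exists_of_octic_gal_equiv_dihedral hf.2.1.separable (a := a) (b := b)
    (by simp) (by exact_mod_cast hsq.ne_zero) e
  rcases key with ⟨t, ht⟩ | ⟨⟨q, hq⟩, h⟩
  · exact absurd ht (pow_four_ne_of_squarefree hsq t)
  obtain ⟨k, rfl⟩ := exists_int_eq_of_pow_eq (n := 2) (c := -(b * (a ^ 2 - 4 * b)))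
    (by norm_num) (by push_cast; exact hq)
  have hab := eq_zero_or_eq_three_of_isMonogenic_octic hf (q := k) (by exact_mod_cast hq)
  have hab0 : a * (a ^ 2 - 3 * b) = 0 := by
    rcases hab with h | ⟨h, h'⟩ <;> simp [*]
  obtain ⟨t, ht | ht⟩ := h (by exact_mod_cast hab0)
  · exact absurd ht (rat_sq_ne_two t)
  · have := eq_two_of_sq_eq hsq ht
    omega

theorem nonempty_mulEquiv_dihedralGroup {G : Type*} [Group G] {n : ℕ} [NeZero n]
    (hcard : Nat.card G = 2 * n) {r s : G} (hr : orderOf r = n) (hs : s ∉ Subgroup.zpowers r)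
    (hss : s * s = 1) (hsr : s * r = r⁻¹ * s) : Nonempty (G ≃* DihedralGroup n) := by
  have hadd : ∀ i j : ZMod n, r ^ (i + j).val = r ^ i.val * r ^ j.val := fun i j => by
    have h := pow_mod_orderOf r (i.val + j.val)
    rw [hr] at h
    rw [ZMod.val_add, h, pow_add]
  have hneg : ∀ i : ZMod n, r ^ (-i).val = (r ^ i.val)⁻¹ := fun i => by
    rw [eq_inv_iff_mul_eq_one, ← hadd]; simp
  have hconj : ∀ m : ℕ, s * r ^ m = (r ^ m)⁻¹ * s := fun m => by
    have : SemiconjBy s r r⁻¹ := hsr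
    simpa using (this.pow_right m).eq
  let f : DihedralGroup n →* G := MonoidHom.mk'
    (fun x => match x with
      | .r i => r ^ i.val
      | .sr i => s * r ^ i.val) (by
    rintro (i | i) (j | j)
    · exact hadd i j
    · change s * r ^ (j - i).val = r ^ i.val * (s * r ^ j.val)
      rw [← mul_assoc, show r ^ i.val * s = s * (r ^ i.val)⁻¹ by
        rw [← hneg, hconj, hneg, inv_inv], mul_assoc, ← hneg, ← hadd, sub_eq_neg_add]
    · change s * r ^ (i + j).val = s * r ^ i.val * r ^ j.val
      rw [hadd, mul_assoc]
    · change r ^ (j - i).val = s * r ^ i.val * (s * r ^ j.val)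
      rw [hconj, mul_assoc, ← mul_assoc s, hss, one_mul, ← hneg, ← hadd, sub_eq_neg_add])
  have hinj : Function.Injective f := by
    rw [injective_iff_map_eq_one]
    rintro (i | i) h
    · change r ^ i.val = 1 at h
      have := orderOf_dvd_of_pow_eq_one h
      rw [hr] at this
      have := Nat.eq_zero_of_dvd_of_lt this (ZMod.val_lt i)
      rw [ZMod.val_eq_zero] at this
      rw [this]; rfl
    · change s * r ^ i.val = 1 at h
      rw [mul_eq_one_iff_eq_inv] at h
      exact absurd (h ▸ inv_mem (Subgroup.npow_mem_zpowers r _)) hs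
  have : Finite G := Nat.finite_of_card_ne_zero (by rw [hcard]; simp [NeZero.ne n])
  have hbij := (Nat.bijective_iff_injective_and_card f).2
    ⟨hinj, by rw [hcard, DihedralGroup.nat_card]⟩
  exact ⟨(MulEquiv.ofBijective f hbij).symm⟩

theorem isEisensteinAt_X_pow_eight_add_two :
    (X ^ 8 + C 2 : ℤ[X]).IsEisensteinAt (Ideal.span {2}) where
  leading := by
    rw [leadingCoeff_X_pow_add_C (by norm_num), Ideal.mem_span_singleton]
    norm_num
  mem := fun {n} hn => by
    rw [natDegree_X_pow_add_C] at hn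
    rw [coeff_add, coeff_X_pow, if_neg hn.ne, zero_add, coeff_C, Ideal.mem_span_singleton]
    split_ifs <;> simp
  notMem := by
    rw [Ideal.span_singleton_pow, Ideal.mem_span_singleton]
    simp only [coeff_add, coeff_X_pow, coeff_C_zero]
    norm_num

theorem irreducible_X_pow_eight_add_two : Irreducible (X ^ 8 + C 2 : ℤ[X]) :=
  isEisensteinAt_X_pow_eight_add_two.irreducible
    ((Ideal.span_singleton_prime two_ne_zero).2 Int.prime_two)
    (monic_X_pow_add_C _ (by norm_num)).isPrimitive (by rw [natDegree_X_pow_add_C]; norm_num)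

theorem irreducible_X_pow_eight_add_two_rat : Irreducible (X ^ 8 + C 2 : ℚ[X]) := by
  have h := (IsPrimitive.Int.irreducible_iff_irreducible_map_cast
    (monic_X_pow_add_C (2 : ℤ) (n := 8) (by norm_num)).isPrimitive).1
      irreducible_X_pow_eight_add_two
  rwa [Polynomial.map_add, Polynomial.map_pow, map_X, map_C] at h

theorem isIntegral_of_pow_eight {K : Type*} [Field K] {θ : K} (hθ : θ ^ 8 = -2) : IsIntegral ℤ θ :=
  IsIntegral.of_pow (n := 8) (by norm_num) (by
    rw [hθ]; simpa using isIntegral_algebraMap (R := ℤ) (A := K) (x := -2))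

section

variable {K : Type*} [Field K] [Algebra ℚ K] {θ : K}

theorem minpoly_rat_of_pow_eight (hθ : θ ^ 8 = -2) : minpoly ℚ θ = X ^ 8 + C 2 := by
  refine (minpoly.eq_of_irreducible_of_monic irreducible_X_pow_eight_add_two_rat ?_
    (monic_X_pow_add_C _ (by norm_num))).symm
  rw [map_add, map_pow, aeval_X, aeval_C, hθ]
  simp

theorem minpoly_int_of_pow_eight (hθ : θ ^ 8 = -2) : minpoly ℤ θ = X ^ 8 + C 2 := by
  apply Polynomial.map_injective (algebraMap ℤ ℚ) Int.cast_injective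
  rw [← minpoly.isIntegrallyClosed_eq_field_fractions' ℚ (isIntegral_of_pow_eight hθ),
    minpoly_rat_of_pow_eight hθ, Polynomial.map_add, Polynomial.map_pow, map_X, map_C]
  rfl

theorem mem_adjoin_of_isIntegral_of_pow_eight (B : PowerBasis ℚ K) (hB : B.gen ^ 8 = -2) {z : K}
    (hz : IsIntegral ℤ z) : z ∈ Algebra.adjoin ℤ {B.gen} := by
  have hfin := B.finite
  have hint := isIntegral_of_pow_eight hB
  have hdeg : Module.finrank ℚ K = 8 := by
    rw [B.finrank, ← B.natDegree_minpoly, minpoly_rat_of_pow_eight hB, natDegree_X_pow_add_C]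
  have hdim : B.dim = 8 := by rw [← B.finrank, hdeg]
  have hnorm : Algebra.norm ℚ B.gen = 2 := by
    rw [Algebra.PowerBasis.norm_gen_eq_coeff_zero_minpoly, minpoly_rat_of_pow_eight hB, hdim,
      coeff_add, coeff_X_pow, coeff_C_zero]
    norm_num
  have hdiscr : Algebra.discr ℚ B.basis = 2 ^ 31 := by
    rw [Algebra.discr_powerBasis_eq_norm, minpoly_rat_of_pow_eight hB, hdeg]
    have : aeval B.gen (derivative (X ^ 8 + C 2 : ℚ[X])) = algebraMap ℚ K 8 * B.gen ^ 7 := by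
      rw [derivative_add, derivative_C, add_zero, derivative_X_pow, map_mul, map_pow, aeval_X,
        aeval_C]
      norm_num
    rw [this, map_mul, map_pow, hnorm, Algebra.norm_algebraMap, hdeg]
    norm_num
  have h := Algebra.discr_mul_isIntegral_mem_adjoin (R := ℤ) ℚ hint hz
  rw [hdiscr] at h
  refine mem_adjoin_of_smul_prime_pow_smul_of_minpoly_isEisensteinAt (p := (2 : ℤ)) (n := 31)
    (K := ℚ) Int.prime_two hint hz ?_ ?_
  · convert h using 1
    rw [← algebraMap_smul ℚ ((2 : ℤ) ^ 31) z]
    norm_num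
  · rw [minpoly_int_of_pow_eight hB]
    exact isEisensteinAt_X_pow_eight_add_two

theorem sq_ne_neg_one_of_pow_eight (B : PowerBasis ℚ K) (hB : B.gen ^ 8 = -2) (z : K) :
    z ^ 2 ≠ -1 := by
  intro hz
  have hchar : CharZero K := algebraRat.charZero K
  have hzint : IsIntegral ℤ z :=
    IsIntegral.of_pow (n := 2) (by norm_num) (by rw [hz]; exact isIntegral_one.neg)
  have h := mem_adjoin_of_isIntegral_of_pow_eight B hB hzint
  rw [Algebra.adjoin_singleton_eq_range_aeval] at h
  obtain ⟨P, hP⟩ := h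
  have hP : aeval B.gen P = z := hP
  have hdvd := minpoly.isIntegrallyClosed_dvd (R := ℤ) (isIntegral_of_pow_eight hB)
    (p := P ^ 2 + 1) (by rw [map_add, map_pow, hP, hz]; simp)
  rw [minpoly_int_of_pow_eight hB] at hdvd
  obtain ⟨Q, hQ⟩ := hdvd
  have h1 := congrArg (fun R : ℤ[X] => ((R.eval 1 : ℤ) : ZMod 3)) hQ
  simp only [eval_add, eval_pow, eval_one, eval_mul, eval_X, eval_C] at h1
  push_cast at h1
  generalize ((eval 1 P : ℤ) : ZMod 3) = x at h1
  generalize ((eval 1 Q : ℤ) : ZMod 3) = y at h1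
  revert x y
  decide

end

theorem isMonogenic_X_pow_eight_add_two : IsMonogenic (X ^ 8 + C 2) := by
  refine ⟨monic_X_pow_add_C _ (by norm_num), ?_, ?_⟩
  · rw [Polynomial.map_add, Polynomial.map_pow, map_X, map_C]
    exact irreducible_X_pow_eight_add_two_rat
  intro K _ _ θ hroot hgen
  have hθ : θ ^ 8 = -2 := by
    rw [map_add, map_pow, aeval_X, aeval_C] at hroot
    simpa using eq_neg_of_add_eq_zero_left hroot
  have hint := isIntegral_of_pow_eight hθ
  refine le_antisymm (Algebra.adjoin_le (Set.singleton_subset_iff.2 hint)) fun z hz => ?_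
  let B := PowerBasis.ofAdjoinEqTop (K := ℚ) hint.tower_top hgen
  have hBgen : B.gen = θ := PowerBasis.ofAdjoinEqTop_gen _ _
  rw [← hBgen]
  exact mem_adjoin_of_isIntegral_of_pow_eight B (by rw [hBgen, hθ]) hz

open IntermediateField in
theorem notMem_adjoin_of_sq_eq_neg_one {L : Type*} [Field L] [Algebra ℚ L] {θ j : L}
    (hθ : θ ^ 8 = -2) (hj : j ^ 2 = -1) : j ∉ ℚ⟮θ⟯ := by
  intro hmem
  have hint : IsIntegral ℚ θ := (isIntegral_of_pow_eight hθ).tower_top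
  refine @sq_ne_neg_one_of_pow_eight ℚ⟮θ⟯ _ (IntermediateField.algebra' _)
    (adjoin.powerBasis hint) ?_ ⟨j, hmem⟩ (Subtype.ext (by simpa using hj))
  rw [adjoin.powerBasis_gen]
  exact Subtype.ext hθ

theorem exists_roots_of_isSplittingField_X_pow_eight_add_two (L : Type*) [Field L] [Algebra ℚ L]
    [IsSplittingField ℚ L (X ^ 8 + C 2)] :
    ∃ θ j ζ : L, θ ^ 8 = -2 ∧ j ^ 2 = -1 ∧ ζ * θ ^ 4 = j - 1 ∧ ζ ^ 2 = j := by
  have hirr := irreducible_X_pow_eight_add_two_rat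
  have hchar : CharZero L := algebraRat.charZero L
  have hsplits := IsSplittingField.splits L (X ^ 8 + C (2 : ℚ))
  obtain ⟨θ, hθ⟩ : ∃ θ : L, θ ^ 8 = -2 := by
    obtain ⟨θ, h⟩ := hsplits.exists_eval_eq_zero (by
      rw [degree_map, degree_X_pow_add_C (by norm_num)]; norm_num)
    refine ⟨θ, ?_⟩
    simp at h
    linear_combination h
  have hθ0 : θ ≠ 0 := by rintro rfl; norm_num at hθ
  obtain ⟨j, hj⟩ : ∃ j : L, j ^ 2 = -1 := by
    have hdvd : (X ^ 2 + C (θ ^ 2) : L[X]) ∣ (X ^ 8 + C (2 : ℚ)).map (algebraMap ℚ L) := by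
      refine ⟨(X ^ 2 - C (θ ^ 2)) * (X ^ 4 + C (θ ^ 4)), ?_⟩
      rw [Polynomial.map_add, Polynomial.map_pow, map_X, map_C, map_ofNat, ← neg_neg (2 : L), ← hθ]
      simp only [C_neg, C_pow]
      ring
    obtain ⟨x, hx⟩ := (hsplits.of_dvd
      (Polynomial.map_ne_zero hirr.ne_zero) hdvd).exists_eval_eq_zero (by
        rw [degree_X_pow_add_C (by norm_num)]; norm_num)
    rw [eval_add, eval_pow, eval_X, eval_C] at hx
    refine ⟨x / θ, ?_⟩
    field_simp
    linear_combination hx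
  obtain ⟨ζ, hζ⟩ : ∃ ζ : L, ζ * θ ^ 4 = j - 1 := ⟨(j - 1) / θ ^ 4, by field_simp⟩
  have hζ2 : ζ ^ 2 = j := by
    have : (2 : L) * (ζ ^ 2 - j) = 0 := by
      linear_combination -(ζ * θ ^ 4 + j - 1) * hζ - hj + ζ ^ 2 * hθ
    rcases mul_eq_zero.1 this with h | h
    · exact absurd h two_ne_zero
    · linear_combination h
  exact ⟨θ, j, ζ, hθ, hj, hζ, hζ2⟩

section

variable {L : Type*} [Field L] [Algebra ℚ L] {θ j ζ : L}

theorem exists_pow_mul_eq_of_pow_eight (hθ : θ ^ 8 = -2) (hj : j ^ 2 = -1) (hζ2 : ζ ^ 2 = j)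
    {x : L} (hx : x ^ 8 = -2) : ∃ i < 8, ζ ^ i * θ = x := by
  have hchar : CharZero L := algebraRat.charZero L
  have hθ0 : θ ≠ 0 := by rintro rfl; norm_num at hθ
  have hζprim : IsPrimitiveRoot ζ 8 := by
    rw [IsPrimitiveRoot.iff_orderOf]
    refine orderOf_eq_prime_pow (p := 2) (n := 2) ?_ ?_
    · rw [show ζ ^ 2 ^ 2 = -1 by rw [← hj, ← hζ2]; ring]
      norm_num
    · rw [show ζ ^ 2 ^ (2 + 1) = (-1) ^ 2 by rw [← hj, ← hζ2]; ring]
      norm_num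
  obtain ⟨i, hi, h⟩ := hζprim.eq_pow_of_pow_eq_one (ξ := x / θ) (by
    rw [div_pow, hx, hθ, div_self (by norm_num)])
  exact ⟨i, hi, by rw [h]; field_simp⟩

open IntermediateField in
theorem sixteen_le_card_gal [FiniteDimensional ℚ L] [IsGalois ℚ L] (hθ : θ ^ 8 = -2)
    (hj : j ^ 2 = -1) : 16 ≤ Nat.card (L ≃ₐ[ℚ] L) := by
  have hint : IsIntegral ℚ θ := (isIntegral_of_pow_eight hθ).tower_top
  have h8 : Module.finrank ℚ ℚ⟮θ⟯ = 8 := by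
    rw [adjoin.finrank hint, minpoly_rat_of_pow_eight hθ, natDegree_X_pow_add_C]
  have h1 : Module.finrank ℚ⟮θ⟯ L ≠ 1 := fun h => by
    rw [IntermediateField.finrank_eq_one_iff_eq_top] at h
    exact notMem_adjoin_of_sq_eq_neg_one hθ hj (h ▸ IntermediateField.mem_top)
  have h0 : 0 < Module.finrank ℚ⟮θ⟯ L := Module.finrank_pos
  rw [IsGalois.card_aut_eq_finrank, ← Module.finrank_mul_finrank ℚ ℚ⟮θ⟯ L, h8]
  omega

variable [IsSplittingField ℚ L (X ^ 8 + C 2)]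

theorem algEquiv_ext_of_pow_eight (hθ : θ ^ 8 = -2) (hj : j ^ 2 = -1) (hζ : ζ * θ ^ 4 = j - 1)
    (hζ2 : ζ ^ 2 = j) {g h : L ≃ₐ[ℚ] L} (h1 : g θ = h θ) (h2 : g j = h j) : g = h := by
  have hchar : CharZero L := algebraRat.charZero L
  have hθ0 : θ ≠ 0 := by rintro rfl; norm_num at hθ
  have hgζ : ∀ g : L ≃ₐ[ℚ] L, g ζ * g θ ^ 4 = g j - 1 := fun g => by
    simpa using congrArg g hζ
  have h3 : g ζ = h ζ := by
    refine mul_right_cancel₀ (pow_ne_zero 4 ((map_ne_zero g).2 hθ0)) ?_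
    rw [hgζ, h1, h2, hgζ]
  have : (g : L →ₐ[ℚ] L) = h := by
    refine AlgHom.ext_of_adjoin_eq_top
      (IsSplittingField.adjoin_rootSet L (X ^ 8 + C (2 : ℚ))) fun x hx => ?_
    have hx8 : x ^ 8 = -2 := by
      have := aeval_eq_zero_of_mem_rootSet hx
      rw [map_add, map_pow, aeval_X, aeval_C, map_ofNat] at this
      linear_combination this
    obtain ⟨i, -, rfl⟩ := exists_pow_mul_eq_of_pow_eight hθ hj hζ2 hx8
    simp [h1, h3]
  exact AlgEquiv.coe_toAlgHom_injective this

theorem card_gal_and_exists_algEquiv (hθ : θ ^ 8 = -2) (hj : j ^ 2 = -1)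
    (hζ : ζ * θ ^ 4 = j - 1) (hζ2 : ζ ^ 2 = j) :
    Nat.card (L ≃ₐ[ℚ] L) = 2 * 8 ∧
      ∀ i < 8, ∀ y, y = j ∨ y = -j → ∃ g : L ≃ₐ[ℚ] L, g θ = ζ ^ i * θ ∧ g j = y := by
  have hfin : FiniteDimensional ℚ L := IsSplittingField.finiteDimensional L (X ^ 8 + C (2 : ℚ))
  have hgal : IsGalois ℚ L :=
    IsGalois.of_separable_splitting_field irreducible_X_pow_eight_add_two_rat.separable
  have hlower := sixteen_le_card_gal hθ hj
  classical
  have hFin : Fintype (L ≃ₐ[ℚ] L) := Fintype.ofFinite _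
  obtain ⟨S, hS, hmem⟩ : ∃ S : Finset (L × L), S.card ≤ 16 ∧
      ∀ x y, (x, y) ∈ S ↔ (∃ i < 8, ζ ^ i * θ = x) ∧ (y = j ∨ y = -j) := by
    refine ⟨((Finset.range 8).image fun i => ζ ^ i * θ) ×ˢ {j, -j}, ?_, by simp⟩
    rw [Finset.card_product]
    exact Nat.mul_le_mul (Finset.card_image_le.trans (Finset.card_range 8).le) Finset.card_le_two
  let Φ : (L ≃ₐ[ℚ] L) → L × L := fun g => (g θ, g j)
  have hΦ : Function.Injective Φ := fun g h hgh =>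
    algEquiv_ext_of_pow_eight hθ hj hζ hζ2 (congrArg Prod.fst hgh) (congrArg Prod.snd hgh)
  have hsub : Finset.univ.image Φ ⊆ S := by
    intro y hy
    obtain ⟨g, -, rfl⟩ := Finset.mem_image.1 hy
    refine (hmem _ _).2 ⟨exists_pow_mul_eq_of_pow_eight hθ hj hζ2 ?_, ?_⟩
    · rw [← map_pow, hθ, map_neg, map_ofNat]
    · rw [← sq_eq_sq_iff_eq_or_eq_neg, ← map_pow, hj, map_neg, map_one]
  have hcardΦ : (Finset.univ.image Φ).card = Nat.card (L ≃ₐ[ℚ] L) := by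
    rw [Finset.card_image_of_injective _ hΦ, Finset.card_univ, Nat.card_eq_fintype_card]
  have hcard : Nat.card (L ≃ₐ[ℚ] L) = 2 * 8 :=
    le_antisymm (hcardΦ ▸ (Finset.card_le_card hsub).trans hS) hlower
  have himage := Finset.eq_of_subset_of_card_le hsub (by rw [hcardΦ]; exact hS.trans hlower)
  refine ⟨hcard, fun i hi y hy => ?_⟩
  have : (ζ ^ i * θ, y) ∈ Finset.univ.image Φ := himage ▸ (hmem _ _).2 ⟨⟨i, hi, rfl⟩, hy⟩
  obtain ⟨g, -, hg⟩ := Finset.mem_image.1 this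
  exact ⟨g, congrArg Prod.fst hg, congrArg Prod.snd hg⟩

end

theorem nonempty_gal_mulEquiv_dihedralGroup (L : Type*) [Field L] [Algebra ℚ L]
    [IsSplittingField ℚ L (X ^ 8 + C 2)] : Nonempty ((L ≃ₐ[ℚ] L) ≃* DihedralGroup 8) := by
  have hchar : CharZero L := algebraRat.charZero L
  obtain ⟨θ, j, ζ, hθ, hj, hζ, hζ2⟩ := exists_roots_of_isSplittingField_X_pow_eight_add_two L
  have hθ0 : θ ≠ 0 := by rintro rfl; norm_num at hθ
  obtain ⟨hcard, hsurj⟩ := card_gal_and_exists_algEquiv hθ hj hζ hζ2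
  have hext : ∀ g h : L ≃ₐ[ℚ] L, g θ = h θ → g j = h j → g = h := fun g h =>
    algEquiv_ext_of_pow_eight hθ hj hζ hζ2
  have hgζ : ∀ g : L ≃ₐ[ℚ] L, g ζ * g θ ^ 4 = g j - 1 := fun g => by
    simpa using congrArg g hζ
  obtain ⟨r, hrθ, hrj⟩ := hsurj 1 (by norm_num) j (Or.inl rfl)
  obtain ⟨s, hsθ, hsj⟩ := hsurj 0 (by norm_num) (-j) (Or.inr rfl)
  rw [pow_one] at hrθ
  rw [pow_zero, one_mul] at hsθ
  have hrζ : r ζ = -ζ := by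
    refine mul_right_cancel₀ (pow_ne_zero 4 ((map_ne_zero r).2 hθ0)) ?_
    rw [hgζ, hrj, hrθ, ← hζ]
    linear_combination ζ * θ ^ 4 * ((ζ ^ 2 + j) * hζ2 + hj)
  have hsζ : s ζ = j * ζ := by
    refine mul_right_cancel₀ (pow_ne_zero 4 ((map_ne_zero s).2 hθ0)) ?_
    rw [hgζ, hsj, hsθ]
    linear_combination -j * hζ - hj
  have hr2θ : (r ^ 2) θ = -(j * θ) := by
    rw [pow_two, AlgEquiv.mul_apply, hrθ, map_mul, hrζ, hrθ, ← hζ2]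
    ring
  have hr2j : (r ^ 2) j = j := by rw [pow_two, AlgEquiv.mul_apply, hrj, hrj]
  have hr4θ : (r ^ 4) θ = -θ := by
    rw [show r ^ 4 = r ^ 2 * r ^ 2 by rw [← pow_add], AlgEquiv.mul_apply, hr2θ, map_neg, map_mul,
      hr2θ, hr2j]
    linear_combination θ * hj
  have hr4j : (r ^ 4) j = j := by
    rw [show r ^ 4 = r ^ 2 * r ^ 2 by rw [← pow_add], AlgEquiv.mul_apply, hr2j, hr2j]
  have hj0 : j ≠ 0 := by rintro rfl; norm_num at hj
  refine nonempty_mulEquiv_dihedralGroup hcard (r := r) (s := s) ?_ ?_ ?_ ?_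
  · refine orderOf_eq_prime_pow (p := 2) (n := 2) (fun h => ?_) (hext _ _ ?_ ?_)
    · have := congrArg (fun g : L ≃ₐ[ℚ] L => g θ) h
      exact hθ0 (self_eq_neg.1 (hr4θ.symm.trans this).symm)
    · rw [show r ^ 2 ^ (2 + 1) = r ^ 4 * r ^ 4 by rw [← pow_add]; rfl, AlgEquiv.mul_apply, hr4θ,
        map_neg, hr4θ, neg_neg, AlgEquiv.one_apply]
    · rw [show r ^ 2 ^ (2 + 1) = r ^ 4 * r ^ 4 by rw [← pow_add]; rfl, AlgEquiv.mul_apply, hr4j,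
        hr4j, AlgEquiv.one_apply]
  · intro hmem
    have hle : Subgroup.zpowers r ≤ MulAction.stabilizer (L ≃ₐ[ℚ] L) j := by
      rw [Subgroup.zpowers_le]
      exact hrj
    have : s j = j := hle hmem
    exact hj0 (self_eq_neg.1 (this.symm.trans hsj))
  · apply hext <;> simp [hsθ, hsj]
  · rw [eq_inv_mul_iff_mul_eq]
    apply hext
    · rw [AlgEquiv.mul_apply, AlgEquiv.mul_apply, hrθ, map_mul, hsζ, hsθ, map_mul, map_mul, hrj,
        hrζ, hrθ]
      linear_combination -θ * (j * hζ2 + hj)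
    · rw [AlgEquiv.mul_apply, AlgEquiv.mul_apply, hrj, hsj, map_neg, hrj]

theorem nonempty_gal_X_pow_eight_add_two :
    Nonempty ((X ^ 8 + C 2 : ℚ[X]).Gal ≃* DihedralGroup 8) :=
  @nonempty_gal_mulEquiv_dihedralGroup (X ^ 8 + C 2 : ℚ[X]).SplittingField _
    _ (IsSplittingField.splittingField _)

theorem stmt_9 (a b : ℤ) :
    (IsMonogenic (X ^ 8 + C a * X ^ 4 + C b) ∧
      Nonempty ((((X ^ 8 + C a * X ^ 4 + C b : Polynomial ℤ).map (Int.castRingHom ℚ)).Gal ≃*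
        DihedralGroup 8))) ↔
    (a = 0 ∧ b = 2) := by
  refine ⟨fun ⟨hf, ⟨e⟩⟩ => eq_zero_and_eq_two_of_isMonogenic hf e, ?_⟩
  rintro ⟨rfl, rfl⟩
  rw [show (X ^ 8 + C 0 * X ^ 4 + C 2 : ℤ[X]) = X ^ 8 + C 2 by
    rw [C_0, zero_mul, add_zero]]
  refine ⟨isMonogenic_X_pow_eight_add_two, ?_⟩
  rw [show (X ^ 8 + C 2 : ℤ[X]).map (Int.castRingHom ℚ) = X ^ 8 + C 2 by
    rw [Polynomial.map_add, Polynomial.map_pow, map_X, map_C, map_ofNat]]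
  exact nonempty_gal_X_pow_eight_add_two
end

section
/- Let p be a prime such that the integer (4p+1)(4p+5) is squarefree. Then the polynomial F(x) = x⁸ + (4p+3)·x⁴ + 1 is monogenic and its Galois group Gal(F) is isomorphic to ℤ/2ℤ × D₄, where D₄ denotes the dihedral group of order 8. -/
open Polynomial

theorem monic_X_pow_eight_add (A : ℤ) : (X ^ 8 + C A * X ^ 4 + 1 : ℤ[X]).Monic := by
  monicity!

theorem natDegree_X_pow_eight_add (A : ℤ) : (X ^ 8 + C A * X ^ 4 + 1 : ℤ[X]).natDegree = 8 := by
  compute_degree!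

theorem map_intCastRingHom_X_pow_eight_add (A : ℤ) :
    (X ^ 8 + C A * X ^ 4 + 1 : ℤ[X]).map (Int.castRingHom ℚ) = X ^ 8 + C (A : ℚ) * X ^ 4 + 1 := by
  simp

theorem irreducible_X_pow_eight_add (A : ℤ) (hA : A % 4 = 3) :
    Irreducible (X ^ 8 + C A * X ^ 4 + 1 : ℤ[X]) := by
  have hA2 : ((A : ℤ) : ZMod 2) = 1 := by
    have : ((A : ℤ) : ZMod 2) = ((1 : ℤ) : ZMod 2) := by
      rw [ZMod.intCast_eq_intCast_iff_dvd_sub]; push_cast; omega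
    simpa using this
  have hmonic : (X ^ 2 + X + 1 : ℤ[X]).Monic := by monicity!
  have hmod : (X ^ 8 + C A * X ^ 4 + 1 : ℤ[X]) %ₘ (X ^ 2 + X + 1) = C (A - 1) * X := by
    refine (div_modByMonic_unique
      (X ^ 2 * (X - 1) * (X ^ 3 + 1) + C A * (X * (X - 1)) + 1) _ hmonic ⟨?_, ?_⟩).2
    · simp only [C_sub, C_1]; ring
    · have h2 : (X ^ 2 + X + 1 : ℤ[X]).degree = 2 := by compute_degree!
      rw [h2]
      exact (degree_C_mul_X_le _).trans_lt (by norm_num)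
  have hker : RingHom.ker (algebraMap ℤ (ZMod 2)) = Ideal.span {2} := by
    have := ZMod.ker_intCastRingHom 2
    simpa using this
  refine generalizedEisenstein (K := ZMod 2) (q := X ^ 2 + X + 1) (p := 4) ?_ hmonic
    (monic_X_pow_eight_add A).isPrimitive (by rw [natDegree_X_pow_eight_add]; norm_num)
    (by rw [(monic_X_pow_eight_add A).leadingCoeff]; simp) ?_ ?_
  · have hm : ((X ^ 2 + X + 1 : ℤ[X]).map (algebraMap ℤ (ZMod 2))) = X ^ 2 + X + 1 := by simp
    have hd : (X ^ 2 + X + 1 : (ZMod 2)[X]).natDegree = 2 := by compute_degree!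
    rw [hm, irreducible_iff_roots_eq_zero_of_degree_le_three (by rw [hd]) (by rw [hd]; norm_num)]
    refine Multiset.eq_zero_of_forall_notMem fun a ha ↦ ?_
    have h := isRoot_of_mem_roots ha
    simp only [IsRoot.def, eval_add, eval_pow, eval_X, eval_one] at h
    clear ha
    revert a; decide
  · rw [(monic_X_pow_eight_add A).leadingCoeff]
    have h2 : (2 : (ZMod 2)[X]) = 0 := CharTwo.two_eq_zero
    have hC : ((A : ℤ) : (ZMod 2)[X]) = 1 := by
      rw [← map_intCast (C : ZMod 2 →+* (ZMod 2)[X]), hA2, C_1]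
    simp
    linear_combination X ^ 4 * hC + (-2 * X - 5 * X ^ 2 - 8 * X ^ 3 - 9 * X ^ 4 - 8 * X ^ 5
      - 5 * X ^ 6 - 2 * X ^ 7) * h2
  · rw [hmod, hker, Ideal.span_singleton_pow]
    intro h
    have h1 := congrArg (fun q ↦ coeff q 1) h
    simp only [coeff_map, coeff_C_mul, coeff_X_one, mul_one, coeff_zero,
      Ideal.Quotient.eq_zero_iff_mem, Ideal.mem_span_singleton] at h1
    omega

theorem exists_notMem_smul_mem_range {R K : Type*} [CommRing R] [IsDomain R] [IsNoetherianRing R]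
    [Field K] [Algebra R K] [IsFractionRing R K] (M : Ideal R) [M.IsPrime] (t : R) (ht : t ∈ M)
    (hM : ∀ a ∈ M, ∃ s ∉ M, t ∣ s * a) (β : K) (hβ : IsIntegral R β) :
    ∃ s ∉ M, ∃ r : R, algebraMap R K s * β = algebraMap R K r := by
  have hle : M.primeCompl ≤ nonZeroDivisors R := M.primeCompl_le_nonZeroDivisors
  let S := Localization.AtPrime M
  let : Algebra S K :=
    IsLocalization.localizationAlgebraOfSubmonoidLe S K M.primeCompl (nonZeroDivisors R) hle
  have : IsScalarTower R S K :=
    IsLocalization.localization_isScalarTower_of_submonoid_le S K M.primeCompl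
      (nonZeroDivisors R) hle
  have : IsFractionRing S K :=
    IsFractionRing.isFractionRing_of_isDomain_of_isLocalization M.primeCompl S K
  have : IsNoetherianRing S := IsLocalization.isNoetherianRing M.primeCompl S inferInstance
  have hprinc : (IsLocalRing.maximalIdeal S).IsPrincipal := by
    refine ⟨algebraMap R S t, ?_⟩
    change _ = Ideal.span _
    refine le_antisymm ?_ ?_
    · rw [← Localization.AtPrime.map_eq_maximalIdeal, Ideal.map_le_iff_le_comap]
      intro a ha
      obtain ⟨s, hs, c, hc⟩ := hM a ha
      rw [Ideal.mem_comap, Ideal.mem_span_singleton]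
      have hu : IsUnit (algebraMap R S s) := IsLocalization.map_units S (⟨s, hs⟩ : M.primeCompl)
      rw [← hu.dvd_mul_left, ← map_mul, hc]
      exact map_dvd _ (dvd_mul_right _ _)
    · rw [Ideal.span_singleton_le_iff_mem, ← Localization.AtPrime.map_eq_maximalIdeal]
      exact Ideal.mem_map_of_mem _ ht
  have : IsPrincipalIdealRing S :=
    ((tfae_of_isNoetherianRing_of_isLocalRing_of_isDomain S).out 4 0).mp hprinc
  obtain ⟨y, hy⟩ := IsIntegrallyClosed.algebraMap_eq_of_integral (R := S) (hβ.tower_top (A := S))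
  obtain ⟨⟨r, s⟩, hrs⟩ := IsLocalization.surj M.primeCompl y
  refine ⟨s, s.2, r, ?_⟩
  rw [← hy, IsScalarTower.algebraMap_apply R S K, IsScalarTower.algebraMap_apply R S K, ← hrs,
    map_mul, mul_comm]

theorem pow_prime_pow_sub_self_mem {R : Type*} [CommRing R] {x : R}
    (hx : Algebra.adjoin ℤ {x} = ⊤) (I : Ideal R) {q : ℕ} (hq : q.Prime) (k : ℕ)
    (hqI : (q : R) ∈ I) (hxI : x ^ q ^ k - x ∈ I) (a : R) : a ^ q ^ k - a ∈ I := by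
  have ha : a ∈ Algebra.adjoin ℤ {x} := hx ▸ Algebra.mem_top
  induction ha using Algebra.adjoin_induction with
  | mem y hy => rwa [Set.mem_singleton_iff.mp hy]
  | algebraMap m =>
    have : Fact q.Prime := ⟨hq⟩
    have h : ((m ^ q ^ k - m : ℤ) : ZMod q) = 0 := by
      push_cast; rw [ZMod.pow_card_pow, sub_self]
    obtain ⟨c, hc⟩ := (ZMod.intCast_zmod_eq_zero_iff_dvd _ _).mp h
    have hc' : (algebraMap ℤ R m) ^ q ^ k - algebraMap ℤ R m = q * algebraMap ℤ R c := by
      rw [← map_pow, ← map_sub, hc]; simp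
    rw [hc']
    exact I.mul_mem_right _ hqI
  | add b c _ _ hb hc =>
    obtain ⟨r, hr⟩ := exists_add_pow_prime_pow_eq hq b c k
    rw [hr]
    have := I.add_mem (I.add_mem hb hc) (I.mul_mem_right (b * c * r) hqI)
    convert this using 1; ring
  | mul b c _ _ hb hc =>
    have := I.add_mem (I.mul_mem_right (c ^ q ^ k) hb) (I.mul_mem_left b hc)
    convert this using 1; ring

theorem exists_notMem_dvd_mul {R : Type*} [CommRing R] {x : R}
    (hx : Algebra.adjoin ℤ {x} = ⊤) (M : Ideal R) [hM : M.IsPrime] {q : ℕ} (hq : q.Prime)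
    {k : ℕ} (hk : k ≠ 0) {t h : R} (hth : t ∣ q * h) (hh : h ∉ M)
    (hxI : x ^ q ^ k - x ∈ Ideal.span {(q : R), t}) (a : R) (ha : a ∈ M) :
    ∃ s ∉ M, t ∣ s * a := by
  have hmem := pow_prime_pow_sub_self_mem hx (Ideal.span {(q : R), t}) hq k
    (Ideal.subset_span (by simp)) hxI a
  have h1 : 1 < q ^ k := Nat.one_lt_pow hk hq.one_lt
  refine ⟨h * (a ^ (q ^ k - 1) - 1), fun hmul ↦ (hM.mem_or_mem hmul).elim hh fun h' ↦ ?_, ?_⟩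
  · have : a ^ (q ^ k - 1) ∈ M := M.pow_mem_of_mem ha _ (by omega)
    exact hM.ne_top ((Ideal.eq_top_iff_one M).mpr (by simpa using M.sub_mem this h'))
  · obtain ⟨u, v, huv⟩ := Ideal.mem_span_pair.mp hmem
    obtain ⟨w, hw⟩ := hth
    refine ⟨w * u + h * v, ?_⟩
    have hpow : a ^ (q ^ k - 1) * a = a ^ q ^ k := by rw [← pow_succ]; congr 1; omega
    linear_combination h * hpow - h * huv + u * hw

section

variable {R : Type*} [CommRing R] {x : R} {A : ℤ}

theorem not_mem_prime_of_root (hroot : x ^ 8 + A * x ^ 4 + 1 = 0) (M : Ideal R) [hM : M.IsPrime] :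
    x ∉ M := fun h ↦
  hM.ne_top ((Ideal.eq_top_iff_one M).mpr (by
    have := M.mul_mem_left (-(x ^ 7 + A * x ^ 3)) h
    convert this using 1
    linear_combination hroot))

theorem exists_local_generator_two (hroot : x ^ 8 + A * x ^ 4 + 1 = 0)
    (hx : Algebra.adjoin ℤ {x} = ⊤) (hA : A % 4 = 3) (M : Ideal R) [hM : M.IsPrime]
    (h2 : (2 : R) ∈ M) : ∃ t ∈ M, ∀ a ∈ M, ∃ s ∉ M, t ∣ s * a := by
  obtain ⟨l, rfl⟩ : ∃ l, A = 4 * l + 3 := ⟨A / 4, by omega⟩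
  push_cast at hroot
  set h : R := 2 * x ^ 7 + 5 * x ^ 6 + 8 * x ^ 5 + (8 - 2 * l) * x ^ 4 + 8 * x ^ 3 + 5 * x ^ 2
    + 2 * x with hh
  have hpow : (x ^ 2 + x + 1) ^ 4 = 2 * h := by linear_combination hroot
  have ht : x ^ 2 + x + 1 ∈ M := hM.mem_of_pow_mem 4 (hpow ▸ M.mul_mem_right _ h2)
  refine ⟨x ^ 2 + x + 1, ht, exists_notMem_dvd_mul hx M Nat.prime_two (k := 2) two_ne_zero (h := h)
    ?_ ?_ ?_⟩
  · exact ⟨(x ^ 2 + x + 1) ^ 3, by push_cast; linear_combination -hpow⟩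
  · intro hmem
    refine not_mem_prime_of_root (A := 4 * l + 3) (by push_cast; exact hroot) M ?_
    have h1 := M.mul_mem_right (x ^ 7 + 2 * x ^ 6 + 4 * x ^ 5 + (4 - l) * x ^ 4 + 4 * x ^ 3
      + 2 * x ^ 2 + x) h2
    have h3 := M.mul_mem_left ((x - 1) * (x ^ 3 + 1) + 1) ht
    have h4 := M.sub_mem (M.add_mem h1 h3) hmem
    convert h4 using 1
    rw [hh]; ring
  · rw [Ideal.mem_span_pair]
    exact ⟨0, x * (x - 1), by ring⟩

theorem exists_local_generator_odd (hroot : x ^ 8 + A * x ^ 4 + 1 = 0)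
    (hx : Algebra.adjoin ℤ {x} = ⊤) {ε : ℤ} (hε : ε ^ 2 = 1) {q : ℕ} (hq : q.Prime) (hq2 : q ≠ 2)
    (hsf : Squarefree (A - 2 * ε)) (hdvd : (q : ℤ) ∣ A - 2 * ε) (M : Ideal R) [hM : M.IsPrime]
    (hqM : (q : R) ∈ M) : ∃ t ∈ M, ∀ a ∈ M, ∃ s ∉ M, t ∣ s * a := by
  obtain ⟨c, hc⟩ := hdvd
  have hcop : IsCoprime (q : ℤ) c := by
    refine (Nat.prime_iff_prime_int.mp hq).coprime_iff_not_dvd.mpr fun ⟨d, hd⟩ ↦ ?_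
    exact (Nat.prime_iff_prime_int.mp hq).not_isUnit (hsf q ⟨d, by rw [hc, hd]; ring⟩)
  have hε' : (ε : R) ^ 2 = 1 := by exact_mod_cast congrArg (Int.cast : ℤ → R) hε
  have hc' : (A : R) - 2 * ε = q * c := by exact_mod_cast congrArg (Int.cast : ℤ → R) hc
  have hpow : (x ^ 4 + ε) ^ 2 = q * (-c * x ^ 4) := by
    linear_combination hroot + hε' - x ^ 4 * hc'
  have ht : x ^ 4 + ε ∈ M := hM.mem_of_pow_mem 2 (hpow ▸ M.mul_mem_right _ hqM)
  refine ⟨x ^ 4 + ε, ht, exists_notMem_dvd_mul hx M hq (k := 2) two_ne_zero (h := -c * x ^ 4)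
    ⟨x ^ 4 + ε, by rw [← hpow, sq]⟩ ?_ ?_⟩
  · intro hmem
    rcases hM.mem_or_mem hmem with h | h
    · obtain ⟨u, v, huv⟩ := hcop
      have huv' : (u : R) * q + v * c = 1 := by
        exact_mod_cast congrArg (Int.cast : ℤ → R) huv
      refine hM.ne_top ((Ideal.eq_top_iff_one M).mpr ?_)
      rw [← huv']
      exact M.add_mem (M.mul_mem_left _ hqM) (M.mul_mem_left _ (by simpa using h))
    · exact not_mem_prime_of_root hroot M (hM.mem_of_pow_mem 4 h)
  · have h8 : 8 ∣ q ^ 2 - 1 := Nat.eight_dvd_sq_sub_one_of_odd (hq.odd_of_ne_two hq2)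
    have hdiv : x ^ 4 + ε ∣ x ^ 8 - 1 := ⟨x ^ 4 - ε, by linear_combination hε'⟩
    obtain ⟨e, he⟩ := h8
    have hdiv2 : x ^ 8 - 1 ∣ x ^ (q ^ 2 - 1) - 1 := by
      rw [he, pow_mul]; simpa using sub_dvd_pow_sub_pow (x ^ 8) 1 e
    have hq1 : q ^ 2 - 1 + 1 = q ^ 2 := Nat.sub_add_cancel (Nat.one_le_pow _ _ hq.pos)
    refine Ideal.mem_of_dvd _ ?_ (Ideal.subset_span (Set.mem_insert_of_mem _ rfl))
    rw [← hq1, pow_succ _ (q ^ 2 - 1), ← sub_one_mul]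
    exact (hdiv.trans hdiv2).mul_right x

theorem exists_local_generator (hroot : x ^ 8 + A * x ^ 4 + 1 = 0)
    (hx : Algebra.adjoin ℤ {x} = ⊤) (hA : A % 4 = 3) (hm : Squarefree (A - 2))
    (hn : Squarefree (A + 2)) (M : Ideal R) [hM : M.IsPrime]
    (hmem : ((4 * (A ^ 2 - 4) : ℤ) : R) ∈ M) : ∃ t ∈ M, ∀ a ∈ M, ∃ s ∉ M, t ∣ s * a := by
  have key : ∀ ε : ℤ, ε ^ 2 = 1 → Squarefree (A - 2 * ε) → ((A - 2 * ε : ℤ) : R) ∈ M →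
      ∃ t ∈ M, ∀ a ∈ M, ∃ s ∉ M, t ∣ s * a := by
    intro ε hε hsf hε'
    obtain ⟨q, hq, hqd, hqM⟩ : ∃ q : ℕ, q.Prime ∧ (q : ℤ) ∣ A - 2 * ε ∧ (q : R) ∈ M := by
      set B := A - 2 * ε
      have hB : B.natAbs ≠ 0 := Int.natAbs_ne_zero.mpr hsf.ne_zero
      have hBM : ((B.natAbs : ℕ) : R) ∈ M := by
        rcases Int.natAbs_eq B with h | h
        · rw [h] at hε'; simpa using hε'
        · rw [h] at hε'; simpa using hε'
      rw [← Nat.prod_primeFactorsList hB, Nat.cast_list_prod, ← Multiset.prod_coe,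
        hM.multiset_prod_mem_iff_exists_mem] at hBM
      obtain ⟨_, hmem, hqM⟩ := hBM
      rw [Multiset.mem_coe] at hmem
      obtain ⟨q, hq, rfl⟩ := List.mem_map.mp hmem
      exact ⟨q, Nat.prime_of_mem_primeFactorsList hq,
        Int.natCast_dvd.mpr (Nat.dvd_of_mem_primeFactorsList hq), hqM⟩
    have hodd : q ≠ 2 := by rintro rfl; omega
    exact exists_local_generator_odd hroot hx hε hq hodd hsf hqd M hqM
  have hfac : ((4 * (A ^ 2 - 4) : ℤ) : R) =
      2 ^ 2 * (((A - 2 * 1 : ℤ) : R) * ((A - 2 * (-1) : ℤ) : R)) := by push_cast; ring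
  rw [hfac] at hmem
  rcases hM.mem_or_mem hmem with h | h
  · exact exists_local_generator_two hroot hx hA M (hM.mem_of_pow_mem 2 h)
  rcases hM.mem_or_mem h with h | h
  · exact key 1 (by norm_num) (by simpa using hm) h
  · exact key (-1) (by norm_num) (by simpa using hn) h

end

theorem minpoly_eq_of_irreducible {B : Type*} [CommRing B] [IsDomain B] [CharZero B] {f : ℤ[X]}
    (hf : f.Monic) (hirr : Irreducible f) {x : B} (hx : aeval x f = 0) : minpoly ℤ x = f := by
  have hinteg : IsIntegral ℤ x := ⟨f, hf, hx⟩
  exact eq_of_monic_of_associated (minpoly.monic hinteg) hf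
    ((minpoly.prime_of_isIntegrallyClosed hinteg).irreducible.associated_of_dvd hirr
      (minpoly.isIntegrallyClosed_dvd hinteg hx))

open NumberField in
theorem mul_mem_adjoin_of_isIntegral {A : ℤ} (hirr : Irreducible (X ^ 8 + C A * X ^ 4 + 1 : ℤ[X]))
    {K : Type*} [Field K] [NumberField K] {θ : K}
    (hroot : θ ^ 8 + A * θ ^ 4 + 1 = 0) (htop : Algebra.adjoin ℚ {θ} = ⊤) {β : K}
    (hβ : IsIntegral ℤ β) : ((4 * (A ^ 2 - 4) : ℤ) : K) * β ∈ Algebra.adjoin ℤ {θ} := by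
  have hmonic := monic_X_pow_eight_add A
  have hθ : aeval θ (X ^ 8 + C A * X ^ 4 + 1 : ℤ[X]) = 0 := by simpa using hroot
  obtain ⟨x, rfl⟩ : ∃ x : 𝓞 K, algebraMap (𝓞 K) K x = θ := ⟨⟨θ, _, hmonic, hθ⟩, rfl⟩
  obtain ⟨b, rfl⟩ : ∃ b : 𝓞 K, algebraMap (𝓞 K) K b = β := ⟨⟨β, hβ⟩, rfl⟩
  have hx : aeval x (X ^ 8 + C A * X ^ 4 + 1 : ℤ[X]) = 0 := by
    apply RingOfIntegers.ext
    simpa using hroot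
  have hmem : aeval x (derivative (minpoly ℤ x)) ∈ conductor ℤ x := by
    have h := conductor_mul_differentIdeal ℤ ℚ K x htop
    exact Ideal.mul_le_left (h ▸ Ideal.mem_span_singleton_self _)
  rw [minpoly_eq_of_irreducible hmonic hirr hx, mem_conductor_iff] at hmem
  have h2 := Set.mem_image_of_mem (IsScalarTower.toAlgHom ℤ (𝓞 K) K) (hmem b)
  have hval : IsScalarTower.toAlgHom ℤ (𝓞 K) K
      (aeval x (derivative (X ^ 8 + C A * X ^ 4 + 1)) * b) =
      (8 * algebraMap (𝓞 K) K x ^ 7 + 4 * A * algebraMap (𝓞 K) K x ^ 3) * algebraMap (𝓞 K) K b := by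
    have h8 : aeval x (8 : ℤ[X]) = 8 := map_ofNat _ 8
    have h4 : aeval x (4 : ℤ[X]) = 4 := map_ofNat _ 4
    have hder : aeval x (derivative (X ^ 8 + C A * X ^ 4 + 1)) = 8 * x ^ 7 + 4 * A * x ^ 3 := by
      simp [h8, h4]
      ring
    rw [IsScalarTower.coe_toAlgHom', hder]
    simp only [map_mul, map_add, map_pow, map_ofNat, map_intCast]
  rw [← Subalgebra.coe_map, AlgHom.map_adjoin, Set.image_singleton, SetLike.mem_coe, hval,
    IsScalarTower.coe_toAlgHom'] at h2
  generalize algebraMap (𝓞 K) K x = θ at *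
  generalize algebraMap (𝓞 K) K b = β at *
  have hmem : θ ∈ Algebra.adjoin ℤ {θ} := Algebra.self_mem_adjoin_singleton ℤ θ
  have hA : (A : K) ∈ Algebra.adjoin ℤ {θ} := intCast_mem _ A
  have h3 := mul_mem (mul_mem (mul_mem (neg_mem (add_mem (pow_mem hmem 4) hA)) hmem)
    (add_mem (add_mem (pow_mem hmem 4) (pow_mem hmem 4)) hA)) h2
  convert h3 using 1
  push_cast
  linear_combination (4 * β * (4 * θ ^ 8 + (A ^ 2 - 4) + 4 * A * θ ^ 4)) * hroot

theorem adjoin_eq_integralClosure (A : ℤ) (hA : A % 4 = 3) (hm : Squarefree (A - 2))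
    (hn : Squarefree (A + 2)) (K : Type*) [Field K] [NumberField K] (θ : K)
    (hθ : aeval θ (X ^ 8 + C A * X ^ 4 + 1 : ℤ[X]) = 0) (htop : Algebra.adjoin ℚ {θ} = ⊤) :
    Algebra.adjoin ℤ {θ} = integralClosure ℤ K := by
  have hinteg : IsIntegral ℤ θ := ⟨_, monic_X_pow_eight_add A, hθ⟩
  have hroot : θ ^ 8 + A * θ ^ 4 + 1 = 0 := by simpa using hθ
  have hcond (β : K) (hβ : IsIntegral ℤ β) :
      ((4 * (A ^ 2 - 4) : ℤ) : K) * β ∈ Algebra.adjoin ℤ {θ} :=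
    mul_mem_adjoin_of_isIntegral (irreducible_X_pow_eight_add A hA) hroot htop hβ
  have hθmem : θ ∈ Algebra.adjoin ℤ {θ} := Algebra.self_mem_adjoin_singleton ℤ θ
  refine le_antisymm (Algebra.adjoin_le (by simpa using! hinteg)) fun β hβ ↦ ?_
  let R := Algebra.adjoin ℤ {θ}
  let y : R := ⟨θ, hθmem⟩
  have hy : Algebra.adjoin ℤ {y} = ⊤ := by
    rw [← Algebra.adjoin_adjoin_coe_preimage (s := {θ})]
    congr 1
    ext z
    simp [y, Subtype.ext_iff]
  have hyroot : y ^ 8 + A * y ^ 4 + 1 = 0 := Subtype.ext (by simpa using hroot)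
  have hN : (4 * (A ^ 2 - 4) : ℤ) ≠ 0 := by
    have h2 : (A - 2) * (A + 2) ≠ 0 := mul_ne_zero hm.ne_zero hn.ne_zero
    intro h
    exact h2 (by linarith)
  have : IsFractionRing R K := by
    refine IsFractionRing.of_field R K fun z ↦ ?_
    obtain ⟨d, hd, hdz⟩ := ((IsFractionRing.isAlgebraic_iff ℤ ℚ K).mpr
      (Algebra.IsAlgebraic.isAlgebraic z)).exists_integral_multiple
    refine ⟨⟨_, hcond _ hdz⟩, algebraMap ℤ R (4 * (A ^ 2 - 4) * d), ?_⟩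
    have hN' : ((4 * (A ^ 2 - 4) * d : ℤ) : K) ≠ 0 := Int.cast_ne_zero.mpr (mul_ne_zero hN hd)
    rw [← IsScalarTower.algebraMap_apply ℤ R K, eq_intCast, eq_div_iff hN']
    change _ = ((4 * (A ^ 2 - 4) : ℤ) : K) * (d • z)
    rw [zsmul_eq_mul]
    push_cast
    ring
  have : IsNoetherianRing R := by
    have : Algebra.FiniteType ℤ R := .adjoin_of_finite (Set.finite_singleton θ)
    exact Algebra.FiniteType.isNoetherianRing ℤ R
  let J : Ideal R :=
    { carrier := {r | (r : K) * β ∈ R}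
      add_mem' := fun {a b} ha hb ↦ by
        simpa [add_mul] using R.add_mem ha hb
      zero_mem' := by simp
      smul_mem' := fun c r hr ↦ by
        simpa [mul_assoc] using R.mul_mem c.2 hr }
  by_contra hβR
  have hJ : J ≠ ⊤ := fun h ↦ hβR (by
    have h1 : (1 : R) ∈ J := h ▸ Submodule.mem_top
    simpa [J] using h1)
  obtain ⟨M, hM, hJM⟩ := Ideal.exists_le_maximal J hJ
  have hNJ : ((4 * (A ^ 2 - 4) : ℤ) : R) ∈ J := by
    have hcast : (((4 * (A ^ 2 - 4) : ℤ) : R) : K) = ((4 * (A ^ 2 - 4) : ℤ) : K) :=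
      map_intCast R.val _
    change (((4 * (A ^ 2 - 4) : ℤ) : R) : K) * β ∈ R
    rw [hcast]
    exact hcond β hβ
  obtain ⟨t, ht, hloc⟩ := exists_local_generator hyroot hy hA hm hn M (hJM hNJ)
  obtain ⟨s, hs, r, hr⟩ := exists_notMem_smul_mem_range (K := K) M t ht hloc β
    (IsIntegral.tower_top hβ)
  exact hs (hJM (show (s : K) * β ∈ R from (show (s : K) * β = r from hr) ▸ r.2))

open IntermediateField in
theorem exists_add_mul_of_mem_adjoin {E : Type*} [Field E] [Algebra ℚ E] {d x : E}
    (hd : IsIntegral ℚ d) (hx : x ∈ ℚ⟮d⟯) : ∃ a ∈ ℚ⟮d ^ 2⟯, ∃ b ∈ ℚ⟮d ^ 2⟯, x = a + b * d := by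
  rw [← mem_toSubalgebra, adjoin_simple_toSubalgebra_of_isAlgebraic hd.isAlgebraic] at hx
  induction hx using Algebra.adjoin_induction with
  | mem y hy => exact ⟨0, zero_mem _, 1, one_mem _, by simp [Set.mem_singleton_iff.mp hy]⟩
  | algebraMap r => exact ⟨_, IntermediateField.algebraMap_mem _ r, 0, zero_mem _, by simp⟩
  | add u v _ _ hu hv =>
    obtain ⟨a, ha, b, hb, rfl⟩ := hu
    obtain ⟨c, hc, e, he, rfl⟩ := hv
    exact ⟨_, add_mem ha hc, _, add_mem hb he, by ring⟩
  | mul u v _ _ hu hv =>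
    obtain ⟨a, ha, b, hb, rfl⟩ := hu
    obtain ⟨c, hc, e, he, rfl⟩ := hv
    exact ⟨_, add_mem (mul_mem ha hc) (mul_mem (mul_mem hb he) (mem_adjoin_simple_self ℚ _)),
      _, add_mem (mul_mem ha he) (mul_mem hb hc), by ring⟩

theorem eq_zero_of_add_mul_eq_zero {E : Type*} [Field E] [Algebra ℚ E] {L : IntermediateField ℚ E}
    {d a b : E} (hd : d ∉ L) (ha : a ∈ L) (hb : b ∈ L) (h : a + b * d = 0) : a = 0 ∧ b = 0 := by
  have hb0 : b = 0 := by
    by_contra hb0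
    refine hd ?_
    have : d = -a / b := by field_simp; linear_combination h
    rw [this]
    exact div_mem (neg_mem ha) hb
  exact ⟨by simpa [hb0] using h, hb0⟩

open IntermediateField in
theorem exists_rat_of_mem_adjoin_pow_four {E : Type*} [Field E] [Algebra ℚ E] {A : ℤ} {y x : E}
    (hy : y ^ 2 + A * y + 1 = 0) (hyi : IsIntegral ℚ y) (hx : x ∈ ℚ⟮y⟯) :
    ∃ s t : ℚ, x = s + t * y := by
  have hCZ : CharZero E := algebraRat.charZero E
  rw [← mem_toSubalgebra, adjoin_simple_toSubalgebra_of_isAlgebraic hyi.isAlgebraic] at hx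
  induction hx using Algebra.adjoin_induction with
  | mem y hy => exact ⟨0, 1, by simp [Set.mem_singleton_iff.mp hy]⟩
  | algebraMap r => exact ⟨r, 0, by simp⟩
  | add u v _ _ hu hv =>
    obtain ⟨a, b, rfl⟩ := hu
    obtain ⟨c, e, rfl⟩ := hv
    exact ⟨a + c, b + e, by push_cast; ring⟩
  | mul u v _ _ hu hv =>
    obtain ⟨a, b, rfl⟩ := hu
    obtain ⟨c, e, rfl⟩ := hv
    exact ⟨a * c - b * e, a * e + b * c - A * b * e, by
      push_cast; linear_combination (b * e : E) * hy⟩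

open IntermediateField in
theorem not_mem_adjoin_of_sq_eq_neg_one {E : Type*} [Field E] [Algebra ℚ E] {A : ℤ} {θ ω : E}
    (hroot : θ ^ 8 + A * θ ^ 4 + 1 = 0) (hdeg : (minpoly ℚ θ).natDegree = 8) (hA : 2 < A)
    (hm : ∀ r : ℚ, r ^ 2 ≠ A - 2) (hn : ∀ r : ℚ, r ^ 2 ≠ A + 2) (hω : ω ^ 2 = -1) :
    ω ∉ ℚ⟮θ⟯ := by
  have hCZ : CharZero E := algebraRat.charZero E
  have hinteg : IsIntegral ℚ θ := by
    by_contra h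
    rw [minpoly.eq_zero h] at hdeg
    simp at hdeg
  have hlow : ∀ g : ℚ[X], g.natDegree < 8 → aeval θ g = 0 → g = 0 := fun g hg h0 ↦ by
    by_contra hne
    have := natDegree_le_of_dvd (minpoly.dvd ℚ θ h0) hne
    omega
  have hy : (θ ^ 4) ^ 2 + A * θ ^ 4 + 1 = 0 := by linear_combination hroot
  have hrat {x : E} (hx : x ∈ ℚ⟮(θ ^ 2) ^ 2⟯) : ∃ s t : ℚ, x = s + t * θ ^ 4 := by
    rw [← pow_mul] at hx
    exact exists_rat_of_mem_adjoin_pow_four hy (hinteg.pow 4) hx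
  have hind1 {s t : ℚ} (h : (s : E) + t * θ ^ 4 = 0) : s = 0 ∧ t = 0 := by
    have h0 := hlow (C s + C t * X ^ 4) (by compute_degree!) (by simpa using h)
    exact ⟨by simpa using congrArg (coeff · 0) h0, by simpa [coeff_C] using congrArg (coeff · 4) h0⟩
  have hind2 : θ ^ 2 ∉ ℚ⟮(θ ^ 2) ^ 2⟯ := fun h ↦ by
    obtain ⟨s, t, hst⟩ := hrat h
    have h0 := hlow (C s + C t * X ^ 4 - X ^ 2) (by compute_degree!) (by simp [hst])
    simpa [coeff_C, coeff_X] using congrArg (coeff · 2) h0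
  have hind3 : θ ∉ ℚ⟮θ ^ 2⟯ := fun h ↦ by
    obtain ⟨a, ha, b, hb, hab⟩ := exists_add_mul_of_mem_adjoin (hinteg.pow 2) h
    obtain ⟨s, t, rfl⟩ := hrat ha
    obtain ⟨u, v, rfl⟩ := hrat hb
    have h0 := hlow (C s + C t * X ^ 4 + (C u + C v * X ^ 4) * X ^ 2 - X) (by compute_degree!)
      (by simp; linear_combination -hab)
    have := congrArg (coeff · 1) h0
    simp [add_mul, mul_assoc, ← pow_add, coeff_X] at this
  have hsq {e : E} (he : e ∈ ℚ⟮(θ ^ 2) ^ 2⟯) : e ^ 2 ≠ -θ ^ 4 := fun h ↦ by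
    obtain ⟨s, t, rfl⟩ := hrat he
    obtain ⟨h1, h2⟩ := hind1 (s := s ^ 2 - t ^ 2) (t := 2 * s * t - A * t ^ 2 + 1) (by
      push_cast; linear_combination h - (t ^ 2 : E) * hy)
    have ht : t ≠ 0 := by rintro rfl; simp at h2
    rcases sq_eq_sq_iff_eq_or_eq_neg.mp (sub_eq_zero.mp h1) with rfl | rfl
    · refine hm (1 / s) ?_
      field_simp
      linear_combination h2
    · refine hn (1 / t) ?_
      field_simp
      linear_combination h2
  intro hmem
  have hθ0 : θ ≠ 0 := by rintro rfl; simp at hroot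
  obtain ⟨a, ha, b, hb, rfl⟩ := exists_add_mul_of_mem_adjoin hinteg hmem
  have hθ2 : θ ^ 2 ∈ ℚ⟮θ ^ 2⟯ := mem_adjoin_simple_self ℚ _
  have hθ4 : (θ ^ 2) ^ 2 ∈ ℚ⟮(θ ^ 2) ^ 2⟯ := mem_adjoin_simple_self ℚ _
  obtain ⟨h1, h2⟩ := eq_zero_of_add_mul_eq_zero hind3
    (a := a ^ 2 + b ^ 2 * θ ^ 2 + 1) (b := a * b + a * b)
    (add_mem (add_mem (pow_mem ha 2) (mul_mem (pow_mem hb 2) hθ2)) (one_mem _))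
    (add_mem (mul_mem ha hb) (mul_mem ha hb)) (by linear_combination hω)
  have hab : a * b = 0 := by linear_combination (1 / 2 : E) * h2
  rcases mul_eq_zero.mp hab with rfl | rfl
  · obtain ⟨c, hc, d, hd, rfl⟩ := exists_add_mul_of_mem_adjoin (hinteg.pow 2) hb
    obtain ⟨h3, h4⟩ := eq_zero_of_add_mul_eq_zero hind2
      (a := c * d * (θ ^ 2) ^ 2 + c * d * (θ ^ 2) ^ 2 + 1) (b := c ^ 2 + d ^ 2 * (θ ^ 2) ^ 2)
      (add_mem (add_mem (mul_mem (mul_mem hc hd) hθ4) (mul_mem (mul_mem hc hd) hθ4)) (one_mem _))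
      (add_mem (pow_mem hc 2) (mul_mem (pow_mem hd 2) hθ4)) (by linear_combination h1)
    have hd0 : d ≠ 0 := by rintro rfl; simp at h3
    refine hsq (div_mem hc hd) ?_
    field_simp
    linear_combination h4
  · obtain ⟨c, hc, d, hd, rfl⟩ := exists_add_mul_of_mem_adjoin (hinteg.pow 2) ha
    obtain ⟨h3, h4⟩ := eq_zero_of_add_mul_eq_zero hind2
      (a := c ^ 2 + d ^ 2 * (θ ^ 2) ^ 2 + 1) (b := c * d + c * d)
      (add_mem (add_mem (pow_mem hc 2) (mul_mem (pow_mem hd 2) hθ4)) (one_mem _))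
      (add_mem (mul_mem hc hd) (mul_mem hc hd)) (by linear_combination h1)
    have hcd : c * d = 0 := by linear_combination (1 / 2 : E) * h4
    rcases mul_eq_zero.mp hcd with rfl | rfl
    · have hd0 : d ≠ 0 := by rintro rfl; simp at h3
      refine hsq (inv_mem hd) ?_
      field_simp
      linear_combination h3
    · obtain ⟨s, t, rfl⟩ := hrat hc
      obtain ⟨h5, h6⟩ := hind1 (s := s ^ 2 - t ^ 2 + 1) (t := 2 * s * t - A * t ^ 2) (by
        push_cast; linear_combination h3 - (t ^ 2 : E) * hy)
      have hA' : (2 : ℚ) < A := by exact_mod_cast hA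
      have h7 : t * (2 * s - A * t) = 0 := by linear_combination h6
      rcases mul_eq_zero.mp h7 with rfl | h8
      · nlinarith
      · have hs : s = A * t / 2 := by linarith
        subst hs
        nlinarith [sq_nonneg t, mul_nonneg (sq_nonneg t) (by nlinarith : (0 : ℚ) ≤ A ^ 2 - 4)]

/-- The sign character `±1` of the group of order two. -/
def signChar (j : Multiplicative (ZMod 2)) : ℤ := if j = 1 then 1 else -1

/-- The exponent of `ω` in the image of `θ` under an element of `ℤ/2ℤ × D₄`. -/
def rotExponent : Multiplicative (ZMod 2) × DihedralGroup 4 → ℤ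
  | (j, .r k) => signChar j * k.val
  | (j, .sr k) => -signChar j * k.val

/-- The exponent of `θ` in the image of `θ` under an element of `ℤ/2ℤ × D₄`. -/
def invExponent (g : Multiplicative (ZMod 2) × DihedralGroup 4) : ℤ := signChar g.1

/-- The exponent of `ω` in the image of `ω` under an element of `ℤ/2ℤ × D₄`. -/
def conjExponent : Multiplicative (ZMod 2) × DihedralGroup 4 → ℤ
  | (j, .r _) => signChar j
  | (j, .sr _) => -signChar j

theorem invExponent_mul : ∀ g h, invExponent (g * h) = invExponent g * invExponent h := by decide

theorem conjExponent_mul : ∀ g h, conjExponent (g * h) = conjExponent g * conjExponent h := by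
  decide

theorem rotExponent_mul : ∀ g h, (4 : ℤ) ∣ rotExponent (g * h) -
    (conjExponent g * rotExponent h + invExponent h * rotExponent g) := by
  decide

theorem invExponent_eq : ∀ g, invExponent g = 1 ∨ invExponent g = -1 := by decide

theorem conjExponent_eq : ∀ g, conjExponent g = 1 ∨ conjExponent g = -1 := by decide

theorem eq_one_of_exponents : ∀ g, (4 : ℤ) ∣ rotExponent g → invExponent g = 1 →
    conjExponent g = 1 → g = 1 := by decide

theorem exists_exponents_eq : ∀ k : Fin 4, ∀ ε : Fin 2, ∀ δ : Fin 2,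
    ∃ g, (4 : ℤ) ∣ rotExponent g - (k : ℕ) ∧ invExponent g = (-1) ^ (ε : ℕ) ∧
      conjExponent g = (-1) ^ (δ : ℕ) := by decide

section

variable {E : Type*} [Field E] {A : ℤ} {θ ω : E}

theorem zpow_eq_zpow_of_four_dvd (hω : ω ^ 2 = -1) {a b : ℤ} (h : 4 ∣ a - b) :
    ω ^ a = ω ^ b := by
  have hω0 : ω ≠ 0 := by rintro rfl; simp at hω
  have h4 : ω ^ (4 : ℤ) = 1 := by
    rw [show (4 : ℤ) = ((4 : ℕ) : ℤ) from rfl, zpow_natCast]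
    linear_combination (ω ^ 2 - 1) * hω
  obtain ⟨c, hc⟩ := h
  rw [show a = 4 * c + b by omega, zpow_add₀ hω0, zpow_mul, h4, one_zpow, one_mul]

theorem four_dvd_of_zpow_eq_one [CharZero E] (hω : ω ^ 2 = -1) {k : ℤ} (h : ω ^ k = 1) :
    4 ∣ k := by
  have hlt := Int.emod_lt_of_pos k (by norm_num : (0 : ℤ) < 4)
  have hnn := Int.emod_nonneg k (by norm_num : (4 : ℤ) ≠ 0)
  rw [zpow_eq_zpow_of_four_dvd hω (b := k % 4) (by omega)] at h
  obtain ⟨j, hj⟩ : ∃ j, k % 4 = j := ⟨_, rfl⟩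
  rw [hj] at h hlt hnn
  have h1 : ω ≠ 1 := by rintro rfl; norm_num at hω
  interval_cases j
  · omega
  · exact absurd (by simpa using h) h1
  · rw [show (2 : ℤ) = ((2 : ℕ) : ℤ) from rfl, zpow_natCast, hω] at h
    norm_num at h
  · rw [show (3 : ℤ) = ((3 : ℕ) : ℤ) from rfl, zpow_natCast] at h
    exact absurd (show ω ^ 2 = 1 by rw [show ω = -1 by linear_combination ω * hω - h]; norm_num)
      (by rw [hω]; norm_num)

theorem exists_eq_zpow_mul_zpow_of_root (hω : ω ^ 2 = -1) (hroot : θ ^ 8 + A * θ ^ 4 + 1 = 0)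
    {ρ : E} (hρ : ρ ^ 8 + A * ρ ^ 4 + 1 = 0) :
    ∃ k : Fin 4, ∃ e : Fin 2, ρ = ω ^ ((k : ℕ) : ℤ) * θ ^ ((-1 : ℤ) ^ (e : ℕ)) := by
  have hθ0 : θ ≠ 0 := by rintro rfl; simp at hroot
  have key : ∀ τ : E, τ ≠ 0 → ρ ^ 4 = τ ^ 4 → ∃ k : Fin 4, ρ = ω ^ ((k : ℕ) : ℤ) * τ := by
    intro τ hτ h
    have hfac : (ρ - τ) * ((ρ + τ) * ((ρ - ω * τ) * (ρ + ω * τ))) = 0 := by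
      linear_combination h - (ρ ^ 2 - τ ^ 2) * τ ^ 2 * hω
    rcases mul_eq_zero.mp hfac with h | h
    · exact ⟨0, by simp; linear_combination h⟩
    rcases mul_eq_zero.mp h with h | h
    · exact ⟨2, by
        rw [zpow_natCast, show ((2 : Fin 4) : ℕ) = 2 from rfl]; linear_combination h - τ * hω⟩
    rcases mul_eq_zero.mp h with h | h
    · exact ⟨1, by simp; linear_combination h⟩
    · exact ⟨3, by
        rw [zpow_natCast, show ((3 : Fin 4) : ℕ) = 3 from rfl]; linear_combination h - ω * τ * hω⟩
  have hfac : (ρ ^ 4 - θ ^ 4) * (ρ ^ 4 - θ⁻¹ ^ 4) = 0 := by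
    field_simp
    linear_combination θ ^ 4 * hρ - ρ ^ 4 * hroot
  rcases mul_eq_zero.mp hfac with h | h
  · obtain ⟨k, hk⟩ := key θ hθ0 (sub_eq_zero.mp h)
    exact ⟨k, 0, by simpa using hk⟩
  · obtain ⟨k, hk⟩ := key θ⁻¹ (inv_ne_zero hθ0) (sub_eq_zero.mp h)
    exact ⟨k, 1, by simpa using hk⟩

open IntermediateField in
theorem exists_algEquiv_of_root_of_sq_eq_neg_one [Algebra ℚ E] [FiniteDimensional ℚ E]
    [IsGalois ℚ E]
    (hmin : minpoly ℚ θ = (X ^ 8 + C (A : ℚ) * X ^ 4 + 1 : ℚ[X])) (hω : ω ^ 2 = -1)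
    (hmem : ω ∉ ℚ⟮θ⟯) {ρ : E} (hρ : ρ ^ 8 + A * ρ ^ 4 + 1 = 0) {δ : ℤ}
    (hδ : δ = 1 ∨ δ = -1) : ∃ σ : Gal(E/ℚ), σ θ = ρ ∧ σ ω = ω ^ δ := by
  have hω0 : ω ≠ 0 := by rintro rfl; simp at hω
  have hinv : ω⁻¹ = -ω := by
    exact inv_eq_of_mul_eq_one_right (by linear_combination -hω)
  have hsign (σ : Gal(E/ℚ)) : σ ω = ω ∨ σ ω = -ω := by
    have h := congrArg σ hω
    rw [map_pow, map_neg, map_one, ← hω] at h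
    exact sq_eq_sq_iff_eq_or_eq_neg.mp h
  obtain ⟨c, hcθ, hcω⟩ : ∃ c : Gal(E/ℚ), c θ = θ ∧ c ω = -ω := by
    rw [← IsGalois.fixedField_fixingSubgroup ℚ⟮θ⟯, mem_fixedField_iff] at hmem
    push Not at hmem
    obtain ⟨c, hc, hne⟩ := hmem
    exact ⟨c, (mem_fixingSubgroup_iff _ _).mp hc θ (mem_adjoin_simple_self ℚ θ),
      (hsign c).resolve_left hne⟩
  obtain ⟨σ, hσ⟩ := minpoly.exists_algEquiv_of_root' (K := ℚ) (x := ρ) (y := θ)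
    (Algebra.IsAlgebraic.isAlgebraic θ) (by rw [hmin]; simpa using hρ)
  rcases hδ with rfl | rfl <;> rcases hsign σ with h | h
  · exact ⟨σ, hσ, by simpa using h⟩
  · exact ⟨σ * c, by simp [hcθ, hσ], by simp [hcω, h]⟩
  · exact ⟨σ * c, by simp [hcθ, hσ], by simp [hcω, h, hinv]⟩
  · exact ⟨σ, hσ, by simp [h, hinv]⟩

theorem pow_eight_ne_one [CharZero E] (hroot : θ ^ 8 + A * θ ^ 4 + 1 = 0) (hA : A ^ 2 ≠ 4) :
    θ ^ 8 ≠ 1 := fun h ↦ hA (by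
  have : ((A ^ 2 : ℤ) : E) = ((4 : ℤ) : E) := by
    push_cast
    linear_combination (A * θ ^ 4 - 2) * hroot - (A ^ 2 - 2 + (A : E) * θ ^ 4) * h
  exact_mod_cast this)

open IntermediateField in
theorem nonempty_gal_mulEquiv [Algebra ℚ E] [FiniteDimensional ℚ E] [IsGalois ℚ E]
    (hroot : θ ^ 8 + A * θ ^ 4 + 1 = 0)
    (hmin : minpoly ℚ θ = (X ^ 8 + C (A : ℚ) * X ^ 4 + 1 : ℚ[X])) (hω : ω ^ 2 = -1)
    (hmem : ω ∉ ℚ⟮θ⟯) (hA : A ^ 2 ≠ 4)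
    (hext : ∀ σ τ : Gal(E/ℚ), σ θ = τ θ → σ ω = τ ω → σ = τ) :
    Nonempty (Gal(E/ℚ) ≃* Multiplicative (ZMod 2) × DihedralGroup 4) := by
  have hCZ : CharZero E := algebraRat.charZero E
  have hθ0 : θ ≠ 0 := by rintro rfl; simp at hroot
  have hω0 : ω ≠ 0 := by rintro rfl; simp at hω
  have hex (g : Multiplicative (ZMod 2) × DihedralGroup 4) : ∃ σ : Gal(E/ℚ),
      σ θ = ω ^ rotExponent g * θ ^ invExponent g ∧ σ ω = ω ^ conjExponent g := by
    refine exists_algEquiv_of_root_of_sq_eq_neg_one hmin hω hmem ?_ (conjExponent_eq g)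
    have h4 : (ω ^ rotExponent g) ^ 4 = 1 := by
      rw [← zpow_natCast, ← zpow_mul, zpow_eq_zpow_of_four_dvd hω (b := 0) (by simp), zpow_zero]
    rcases invExponent_eq g with h | h
    · rw [h, zpow_one]
      linear_combination hroot + (θ ^ 8 * ((ω ^ rotExponent g) ^ 4 + 1) + A * θ ^ 4) * h4
    · have h8 : (ω ^ rotExponent g) ^ 8 = 1 := by
        rw [show 8 = 4 * 2 from rfl, pow_mul, h4, one_pow]
      rw [h, zpow_neg_one, mul_pow, mul_pow, h8, h4]
      field_simp
      linear_combination hroot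
  choose φ hφθ hφω using hex
  have hmul (g h) : φ (g * h) = φ g * φ h := by
    refine hext _ _ ?_ ?_
    · rw [AlgEquiv.mul_apply, hφθ, hφθ h, map_mul, map_zpow₀, map_zpow₀, hφω, hφθ g, mul_zpow,
        ← zpow_mul, ← zpow_mul, ← zpow_mul, ← mul_assoc, ← zpow_add₀ hω0, invExponent_mul]
      congr 1
      exact zpow_eq_zpow_of_four_dvd hω (by
        have := rotExponent_mul g h
        rwa [mul_comm (invExponent h)] at this)
    · rw [AlgEquiv.mul_apply, hφω, hφω h, map_zpow₀, hφω, ← zpow_mul, conjExponent_mul]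
  let ψ : Multiplicative (ZMod 2) × DihedralGroup 4 →* Gal(E/ℚ) := MonoidHom.mk' φ hmul
  have hinj : Function.Injective ψ := by
    rw [injective_iff_map_eq_one]
    intro g hg
    have h1 : ω ^ rotExponent g * θ ^ invExponent g = θ := by
      rw [← hφθ]; exact congrArg (· θ) hg
    have h2 : ω ^ conjExponent g = ω := by
      rw [← hφω]; exact congrArg (· ω) hg
    have hδ : conjExponent g = 1 := by
      refine (conjExponent_eq g).resolve_right fun h ↦ ?_
      rw [h, zpow_neg_one, inv_eq_iff_eq_inv, ← mul_eq_one_iff_eq_inv₀ hω0, ← sq, hω] at h2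
      norm_num at h2
    have h4 : (ω ^ rotExponent g) ^ 4 = 1 := by
      rw [← zpow_natCast, ← zpow_mul, zpow_eq_zpow_of_four_dvd hω (b := 0) (by simp), zpow_zero]
    have hε : invExponent g = 1 := by
      refine (invExponent_eq g).resolve_right fun h ↦ pow_eight_ne_one hroot hA ?_
      rw [h, zpow_neg_one, mul_inv_eq_iff_eq_mul₀ hθ0] at h1
      rw [← h4, h1]; ring
    refine eq_one_of_exponents g (four_dvd_of_zpow_eq_one hω ?_) hε hδ
    rw [hε, zpow_one] at h1
    exact mul_right_cancel₀ hθ0 (h1.trans (one_mul θ).symm)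
  have hsurj : Function.Surjective ψ := by
    intro σ
    obtain ⟨k, e, hk⟩ := exists_eq_zpow_mul_zpow_of_root hω hroot (ρ := σ θ) (by
      simpa using congrArg σ hroot)
    obtain ⟨d, hd⟩ : ∃ d : Fin 2, σ ω = ω ^ ((-1 : ℤ) ^ (d : ℕ)) := by
      have h := congrArg σ hω
      rw [map_pow, map_neg, map_one, ← hω] at h
      rcases sq_eq_sq_iff_eq_or_eq_neg.mp h with h | h
      · exact ⟨0, by simpa using h⟩
      · refine ⟨1, ?_⟩
        simp
        rw [h]; field_simp; linear_combination -hω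
    obtain ⟨g, h1, h2, h3⟩ := exists_exponents_eq k e d
    refine ⟨g, hext _ _ ?_ ?_⟩
    · rw [hk, ← h2, ← zpow_eq_zpow_of_four_dvd hω h1]; exact hφθ g
    · rw [hd, ← h3]; exact hφω g
  exact ⟨(MulEquiv.ofBijective ψ ⟨hinj, hsurj⟩).symm⟩

end

theorem sq_ne_of_squarefree {z : ℤ} (hz : Squarefree z) (h1 : 1 < z) (r : ℚ) : r ^ 2 ≠ z := by
  intro h
  obtain ⟨s, rfl⟩ := Rat.isSquare_intCast_iff.mp ⟨r, by rw [← h, sq]⟩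
  rcases Int.isUnit_iff.mp (hz s dvd_rfl) with rfl | rfl <;> norm_num at h1

theorem nonempty_gal_mulEquiv_of_isSplittingField {A : ℤ} (hA : 3 < A) {f : ℚ[X]}
    (hf : f = X ^ 8 + C (A : ℚ) * X ^ 4 + 1) (hirr : Irreducible f) (hmonic : f.Monic)
    (hdeg : f.natDegree = 8) (hm : Squarefree (A - 2)) (hn : Squarefree (A + 2))
    (E : Type*) [Field E] [Algebra ℚ E] [IsSplittingField ℚ E f] :
    Nonempty (Gal(E/ℚ) ≃* Multiplicative (ZMod 2) × DihedralGroup 4) := by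
  have : IsGalois ℚ E := IsGalois.of_separable_splitting_field hirr.separable
  have : FiniteDimensional ℚ E := IsSplittingField.finiteDimensional E f
  have hsplits := IsSplittingField.splits E f
  obtain ⟨θ, hθ⟩ := hsplits.exists_eval_eq_zero (by
    rw [degree_map, degree_eq_natDegree hirr.ne_zero, hdeg]; norm_num)
  have haeval : aeval θ f = 0 := by rwa [aeval_def, ← eval_map]
  have hmin : minpoly ℚ θ = f := (minpoly.eq_of_irreducible_of_monic hirr haeval hmonic).symm
  have hiff (ρ : E) : aeval ρ f = 0 ↔ ρ ^ 8 + A * ρ ^ 4 + 1 = 0 := by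
    simp [hf]
  have hroot := (hiff θ).mp haeval
  have hθ0 : θ ≠ 0 := by rintro rfl; simp at hroot
  obtain ⟨ω, hω⟩ : ∃ ω : E, ω ^ 2 = -1 := by
    have hdvd : (X ^ 2 + C (θ ^ 2) : E[X]) ∣ f.map (algebraMap ℚ _) := by
      refine ⟨(X ^ 2 - C (θ ^ 2)) * (X ^ 4 - C (θ⁻¹ ^ 4)), ?_⟩
      have hsum : (A : E) = -(θ ^ 4 + θ⁻¹ ^ 4) := by
        field_simp
        linear_combination hroot
      have hone : (C θ : E[X]) ^ 4 * C θ⁻¹ ^ 4 = 1 := by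
        rw [← mul_pow, ← C_mul, mul_inv_cancel₀ hθ0, C_1, one_pow]
      have hmap : f.map (algebraMap ℚ E) =
          X ^ 8 + C (A : E) * X ^ 4 + 1 := by
        simp [hf]
      rw [hmap, hsum]
      simp only [C_neg, C_add, C_pow]
      linear_combination -hone
    have hne : f.map (algebraMap ℚ E) ≠ 0 := map_ne_zero hirr.ne_zero
    obtain ⟨η, hη⟩ := (hsplits.of_dvd hne hdvd).exists_eval_eq_zero (by
      rw [degree_X_pow_add_C two_pos]; norm_num)
    simp only [eval_add, eval_pow, eval_X, eval_C] at hη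
    exact ⟨η / θ, by field_simp; linear_combination hη⟩
  have hmem := not_mem_adjoin_of_sq_eq_neg_one hroot (by rw [hmin, hdeg]) (by linarith)
    (by simpa using sq_ne_of_squarefree hm (by linarith))
    (by simpa using sq_ne_of_squarefree hn (by linarith)) hω
  refine nonempty_gal_mulEquiv hroot (hmin.trans hf) hω hmem (by nlinarith) fun σ τ h₁ h₂ ↦ ?_
  refine AlgEquiv.coe_toAlgHom_injective (AlgHom.ext_of_adjoin_eq_top
    (IsSplittingField.adjoin_rootSet E f) fun ρ hρ ↦ ?_)
  obtain ⟨k, e, rfl⟩ := exists_eq_zpow_mul_zpow_of_root hω hroot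
    ((hiff ρ).mp (mem_rootSet.mp hρ).2)
  simp [h₁, h₂]

theorem stmt_11 (p : ℕ) (hp : p.Prime)
    (hsf : Squarefree ((4 * (p : ℤ) + 1) * (4 * (p : ℤ) + 5))) :
    IsMonogenic (X ^ 8 + C (4 * (p : ℤ) + 3) * X ^ 4 + 1) ∧
      Nonempty ((((X ^ 8 + C (4 * (p : ℤ) + 3) * X ^ 4 + 1 : Polynomial ℤ).map
        (Int.castRingHom ℚ)).Gal ≃* Multiplicative (ZMod 2) × DihedralGroup 4)) := by
  have hmod : (4 * (p : ℤ) + 3) % 4 = 3 := by omega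
  have hpos : 3 < 4 * (p : ℤ) + 3 := by have := hp.pos; omega
  have hm : Squarefree (4 * (p : ℤ) + 3 - 2) := by
    rw [show 4 * (p : ℤ) + 3 - 2 = 4 * p + 1 by ring]
    exact hsf.of_mul_left
  have hn : Squarefree (4 * (p : ℤ) + 3 + 2) := by
    rw [show 4 * (p : ℤ) + 3 + 2 = 4 * p + 5 by ring]
    exact hsf.of_mul_right
  have hmonic := monic_X_pow_eight_add (4 * (p : ℤ) + 3)
  have hirr := (hmonic.irreducible_iff_irreducible_map_fraction_map (K := ℚ)).mp
    (irreducible_X_pow_eight_add _ hmod)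
  refine ⟨⟨hmonic, hirr, fun K _ _ θ ↦ adjoin_eq_integralClosure _ hmod hm hn K θ⟩, ?_⟩
  exact nonempty_gal_mulEquiv_of_isSplittingField hpos (map_intCastRingHom_X_pow_eight_add _)
    hirr (hmonic.map _) (by rw [hmonic.natDegree_map, natDegree_X_pow_eight_add]) hm hn
    (SplittingField _)
end

section
/- Let a ∈ ℤ with 4 ∤ a and a ≠ 0, and suppose that either (i) a is odd and a² + 4 is squarefree, or (ii) a ≡ 2 (mod 4) and (a² + 4)/8 is squarefree. If the polynomial F(x) = x⁸ + a·x⁴ − 1 is irreducible over ℚ, then F(x) is monogenic. -/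
open Polynomial

/-- A polynomial Bézout relation over `ℤ` modulo `p` gives coprimality over `ZMod p`. -/
lemma isCoprime_map_of_eq_one_add {p : ℕ} {A B U V W : ℤ[X]}
    (h : U * A + V * B = 1 + C (p : ℤ) * W) :
    IsCoprime (A.map (Int.castRingHom (ZMod p))) (B.map (Int.castRingHom (ZMod p))) := by
  refine ⟨U.map (Int.castRingHom (ZMod p)), V.map (Int.castRingHom (ZMod p)), ?_⟩
  rw [← Polynomial.map_mul, ← Polynomial.map_mul, ← Polynomial.map_add, h]
  simp

lemma exists_eq_C_mul_of_map_eq_zero {p : ℕ} {P : ℤ[X]}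
    (h : P.map (Int.castRingHom (ZMod p)) = 0) : ∃ S, P = C (p : ℤ) * S := by
  refine (C_dvd_iff_dvd_coeff _ _).2 fun i => ?_
  have := congrArg (fun q => q.coeff i) h
  simpa [ZMod.intCast_zmod_eq_zero_iff_dvd] using this

lemma exists_lift_of_map_dvd {p : ℕ} {H P : ℤ[X]}
    (h : H.map (Int.castRingHom (ZMod p)) ∣ P.map (Int.castRingHom (ZMod p))) :
    ∃ Q S, P = H * Q + C (p : ℤ) * S := by
  obtain ⟨q, hq⟩ := h
  obtain ⟨Q, rfl⟩ := Polynomial.map_surjective (Int.castRingHom (ZMod p))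
    ZMod.intCast_surjective q
  obtain ⟨S, hS⟩ := exists_eq_C_mul_of_map_eq_zero (p := p) (P := P - H * Q)
    (by rw [Polynomial.map_sub, Polynomial.map_mul, hq, sub_self])
  exact ⟨Q, S, by rw [← hS]; ring⟩

lemma exists_eq_one_add_of_isCoprime_map {p : ℕ} {A B : ℤ[X]}
    (h : IsCoprime (A.map (Int.castRingHom (ZMod p))) (B.map (Int.castRingHom (ZMod p)))) :
    ∃ U V W : ℤ[X], U * A + V * B = 1 + C (p : ℤ) * W := by
  obtain ⟨u, v, huv⟩ := h
  obtain ⟨U, rfl⟩ := Polynomial.map_surjective (Int.castRingHom (ZMod p))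
    ZMod.intCast_surjective u
  obtain ⟨V, rfl⟩ := Polynomial.map_surjective (Int.castRingHom (ZMod p))
    ZMod.intCast_surjective v
  obtain ⟨W, hW⟩ := exists_eq_C_mul_of_map_eq_zero (p := p) (P := U * A + V * B - 1)
    (by simp [huv])
  exact ⟨U, V, W, by rw [← hW]; ring⟩

section

variable {K : Type*} [Field K] {θ : K}

/-- If `P(θ)` is divisible by `m` in the integral closure of `ℤ`, then some power of it is
divisible by `m` in `ℤ[θ]`. -/
lemma exists_pow_eq_mul_aeval {m : ℕ} {P : ℤ[X]} {z : K} (hz : IsIntegral ℤ z)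
    (h : aeval θ P = m * z) : ∃ n, ∃ T : ℤ[X], aeval θ P ^ n = m * aeval θ T := by
  obtain ⟨q, hq, hqz⟩ := hz
  refine ⟨q.natDegree,
    -∑ i ∈ Finset.range q.natDegree,
      C (q.coeff i * (m : ℤ) ^ (q.natDegree - 1 - i)) * P ^ i, ?_⟩
  have hsum : z ^ q.natDegree = -∑ i ∈ Finset.range q.natDegree, (q.coeff i : K) * z ^ i := by
    rw [eval₂_eq_sum_range, Finset.sum_range_succ, hq.coeff_natDegree] at hqz
    simp only [map_one, one_mul] at hqz
    simpa using eq_neg_of_add_eq_zero_right hqz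
  rw [h, mul_pow, hsum]
  simp only [map_neg, map_sum, map_mul, map_pow, h, mul_neg, Finset.mul_sum, mul_pow,
    eq_intCast, map_intCast, map_natCast]
  congr 1
  refine Finset.sum_congr rfl fun i hi => ?_
  have hi := Finset.mem_range.1 hi
  have hpow : (m : K) ^ q.natDegree = m * (m ^ (q.natDegree - 1 - i) * m ^ i) := by
    rw [← pow_add, ← pow_succ']
    congr 1
    omega
  rw [hpow]
  ring

variable {F H R : ℤ[X]} {p e : ℕ}

/-- If a power of `P(θ)` is divisible by `p` in the integral closure of `ℤ`, and `H` is the radical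
of `F` modulo `p`, then `H` divides `P` modulo `p`. -/
lemma exists_eq_mul_add_of_pow_eq (hp : p.Prime) (hdvd : ∀ P : ℤ[X], aeval θ P = 0 → F ∣ P)
    (he : e ≠ 0) (hF : F = H ^ e + C (p : ℤ) * R)
    (hsep : (H.map (Int.castRingHom (ZMod p))).Separable) {P : ℤ[X]} {n : ℕ} {z : K}
    (hz : IsIntegral ℤ z) (h : aeval θ P ^ n = p * z) :
    ∃ Q S, P = H * Q + C (p : ℤ) * S := by
  have := Fact.mk hp
  rw [← map_pow] at h
  obtain ⟨m, T, hT⟩ := exists_pow_eq_mul_aeval hz h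
  have hd : F ∣ (P ^ n) ^ m - C (p : ℤ) * T := hdvd _ (by simpa [sub_eq_zero] using hT)
  have hHF : H.map (Int.castRingHom (ZMod p)) ∣ F.map (Int.castRingHom (ZMod p)) := by
    have : F.map (Int.castRingHom (ZMod p)) = H.map (Int.castRingHom (ZMod p)) ^ e := by
      simp [hF]
    exact this ▸ dvd_pow_self _ he
  have hmap : ((P ^ n) ^ m - C (p : ℤ) * T).map (Int.castRingHom (ZMod p)) =
      P.map (Int.castRingHom (ZMod p)) ^ (n * m) := by
    simp [pow_mul]
  have hdm := hHF.trans (Polynomial.map_dvd (Int.castRingHom (ZMod p)) hd)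
  rw [hmap] at hdm
  exact exists_lift_of_map_dvd (hsep.squarefree.isRadical _ _ hdm)

/-- Dedekind's criterion at `p`, when `F` is a power of a separable polynomial modulo `p`:
`ℤ[θ]` is `p`-saturated in the integral closure of `ℤ`. -/
lemma mem_adjoin_of_prime_mul_mem [CharZero K] (hp : p.Prime) (hθ : aeval θ F = 0)
    (hθint : IsIntegral ℤ θ) (hdvd : ∀ P : ℤ[X], aeval θ P = 0 → F ∣ P)
    (he : e ≠ 0) (hF : F = H ^ e + C (p : ℤ) * R)
    (hsep : (H.map (Int.castRingHom (ZMod p))).Separable)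
    (hcop : IsCoprime (R.map (Int.castRingHom (ZMod p))) (H.map (Int.castRingHom (ZMod p))))
    {α : K} (hα : IsIntegral ℤ α) (hpα : (p : K) * α ∈ Algebra.adjoin ℤ {θ}) :
    α ∈ Algebra.adjoin ℤ {θ} := by
  have hp0 : (p : K) ≠ 0 := by exact_mod_cast hp.ne_zero
  have hintP (P : ℤ[X]) : IsIntegral ℤ (aeval θ P) :=
    adjoin_le_integralClosure hθint (aeval_mem_adjoin_singleton ℤ θ)
  rw [Algebra.adjoin_singleton_eq_range_aeval] at hpα ⊢
  obtain ⟨P, hP⟩ := hpα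
  have hP : aeval θ P = p * α := hP
  have hη : aeval θ H ^ e = -(p * aeval θ R) := by
    refine eq_neg_of_add_eq_zero_left ?_
    simpa [hF] using hθ
  obtain ⟨U, V, W, hUVW⟩ : ∃ U V W : ℤ[X], U * R + V * H ^ e = 1 + C (p : ℤ) * W := by
    refine exists_eq_one_add_of_isCoprime_map ?_
    rw [Polynomial.map_pow]
    exact hcop.pow_right
  have hunit : (aeval θ U - p * aeval θ V) * aeval θ R = 1 + p * aeval θ W := by
    have := congrArg (aeval θ) hUVW
    simp only [map_add, map_mul, map_pow, hη, map_one, map_natCast] at this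
    linear_combination this
  have key : ∀ k ≤ e, ∃ Q S, P = H ^ k * Q + C (p : ℤ) * S := by
    intro k
    induction k with
    | zero => exact fun _ => ⟨P, 0, by simp⟩
    | succ k ih =>
      intro hk
      obtain ⟨Q, S, hQS⟩ := ih (by omega)
      obtain ⟨j, rfl⟩ : ∃ j, e = k + (j + 1) := ⟨e - k - 1, by omega⟩
      have hαQ : aeval θ H ^ k * aeval θ Q = p * (α - aeval θ S) := by
        have := congrArg (aeval θ) hQS
        simp only [map_add, map_mul, map_pow, hP, map_natCast] at this
        linear_combination -this
      have hρ : aeval θ R * aeval θ Q = -(aeval θ H ^ (j + 1) * (α - aeval θ S)) := by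
        refine mul_left_cancel₀ hp0 ?_
        rw [pow_add] at hη
        linear_combination aeval θ Q * hη - aeval θ H ^ (j + 1) * hαQ
      set τ : K := -((aeval θ U - p * aeval θ V) * (α - aeval θ S)) with hτ
      have hτint : IsIntegral ℤ τ := by
        refine (IsIntegral.mul ?_ (hα.sub (hintP S))).neg
        have := hintP (U - C (p : ℤ) * V)
        simpa using this
      have hQ : aeval θ (Q + C (p : ℤ) * (W * Q)) = aeval θ H ^ (j + 1) * τ := by
        simp only [map_add, map_mul, map_natCast, hτ]
        linear_combination (-aeval θ Q) * hunit + (aeval θ U - p * aeval θ V) * hρ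
      have hpow : aeval θ (Q + C (p : ℤ) * (W * Q)) ^ (k + (j + 1)) =
          p * ((-aeval θ R) * aeval θ H ^ ((k + (j + 1)) * j) * τ ^ (k + (j + 1))) := by
        rw [hQ, mul_pow, ← pow_mul, show (j + 1) * (k + (j + 1)) =
          (k + (j + 1)) + (k + (j + 1)) * j by ring, pow_add _ (k + (j + 1)), hη]
        ring
      obtain ⟨Q', S', hQS'⟩ := exists_eq_mul_add_of_pow_eq hp hdvd he hF hsep
        (((hintP R).neg.mul ((hintP H).pow _)).mul (hτint.pow _)) hpow
      refine ⟨Q', S + H ^ k * (S' - W * Q), ?_⟩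
      rw [hQS]
      linear_combination H ^ k * hQS'
  obtain ⟨Q, S, hQS⟩ := key e le_rfl
  refine ⟨S - R * Q, ?_⟩
  refine mul_left_cancel₀ hp0 ?_
  have := congrArg (aeval θ) hQS
  simp only [map_add, map_mul, map_pow, hη, hP, map_natCast] at this
  change p * aeval θ (S - R * Q) = p * α
  rw [map_sub, map_mul]
  linear_combination -this

/-- A `p`-saturated order `ℤ[θ]`, for all primes `p`, is the full integral closure. -/
lemma adjoin_eq_integralClosure_of_saturated [CharZero K] (hθint : IsIntegral ℤ θ)
    (htop : Algebra.adjoin ℚ {θ} = (⊤ : Subalgebra ℚ K))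
    (hsat : ∀ p : ℕ, p.Prime → ∀ α : K, IsIntegral ℤ α →
      (p : K) * α ∈ Algebra.adjoin ℤ {θ} → α ∈ Algebra.adjoin ℤ {θ}) :
    Algebra.adjoin ℤ {θ} = integralClosure ℤ K := by
  refine le_antisymm (adjoin_le_integralClosure hθint) fun α hα => ?_
  have hall : ∀ n : ℕ, n ≠ 0 → ∀ α : K, IsIntegral ℤ α →
      (n : K) * α ∈ Algebra.adjoin ℤ {θ} → α ∈ Algebra.adjoin ℤ {θ} := by
    intro n
    induction n using induction_on_primes with
    | zero => exact fun h => absurd rfl h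
    | one => simp
    | prime_mul p n hp ih =>
      intro hn α hα h
      refine ih (right_ne_zero_of_mul hn) α hα (hsat p hp _ ?_ ?_)
      · simpa using (isIntegral_algebraMap (R := ℤ) (A := K) (x := (n : ℤ))).mul hα
      · rwa [← mul_assoc, ← Nat.cast_mul]
  obtain ⟨n, hn, hmem⟩ : ∃ n : ℕ, n ≠ 0 ∧ (n : K) * α ∈ Algebra.adjoin ℤ {θ} := by
    have hα' : α ∈ Algebra.adjoin ℚ {θ} := htop ▸ Algebra.mem_top
    clear hα
    induction hα' using Algebra.adjoin_induction with
    | mem x hx => exact ⟨1, one_ne_zero, by simpa using Algebra.subset_adjoin hx⟩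
    | algebraMap r =>
      refine ⟨r.den, r.den_nz, ?_⟩
      have : (r.den : K) * algebraMap ℚ K r = algebraMap ℤ K r.num := by
        have := congrArg (algebraMap ℚ K) (Rat.den_mul_eq_num r)
        rwa [map_mul, map_natCast, map_intCast, ← eq_intCast (algebraMap ℤ K)] at this
      rw [this]
      exact Subalgebra.algebraMap_mem _ _
    | add x y _ _ hx hy =>
      obtain ⟨m, hm, hx⟩ := hx
      obtain ⟨n, hn, hy⟩ := hy
      refine ⟨m * n, mul_ne_zero hm hn, ?_⟩
      have : ((m * n : ℕ) : K) * (x + y) = n * (m * x) + m * (n * y) := by push_cast; ring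
      rw [this]
      exact add_mem (mul_mem (natCast_mem _ n) hx) (mul_mem (natCast_mem _ m) hy)
    | mul x y _ _ hx hy =>
      obtain ⟨m, hm, hx⟩ := hx
      obtain ⟨n, hn, hy⟩ := hy
      refine ⟨m * n, mul_ne_zero hm hn, ?_⟩
      have : ((m * n : ℕ) : K) * (x * y) = (m * x) * (n * y) := by push_cast; ring
      rw [this]
      exact mul_mem hx hy
  exact hall n hn α hα hmem

end

/-- Away from `2 (a ^ 2 + 4)`, the polynomial `X ^ 8 + a X ^ 4 - 1` is separable. -/
lemma separable_map_of_not_dvd {a : ℤ} {p : ℕ} (hp : p.Prime) (hp2 : p ≠ 2)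
    (hpa : ¬ (p : ℤ) ∣ a ^ 2 + 4) :
    ((X ^ 8 + C a * X ^ 4 - 1 : ℤ[X]).map (Int.castRingHom (ZMod p))).Separable := by
  have hp' := Nat.prime_iff_prime_int.1 hp
  have h4 : ¬ (p : ℤ) ∣ 4 * (a ^ 2 + 4) := by
    intro h
    rcases hp'.dvd_or_dvd h with h | h
    · have h2 : (p : ℤ) ∣ 2 := hp'.dvd_of_dvd_pow (n := 2) (by norm_num; exact h)
      exact hp2 ((Nat.prime_dvd_prime_iff_eq hp Nat.prime_two).1 (by exact_mod_cast h2))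
    · exact hpa h
  obtain ⟨w, u, hwu⟩ := (Prime.coprime_iff_not_dvd hp').2 h4
  rw [separable_def, derivative_map]
  refine isCoprime_map_of_eq_one_add
    (U := -C u * (4 * (C a ^ 2 + 4) + 16 + 16 * (X ^ 8 + C a * X ^ 4 - 1)))
    (V := C u * (X * (X ^ 4 + C a) * (2 * X ^ 4 + C a))) (W := -C w) ?_
  have hC : C w * C (p : ℤ) + C u * (4 * (C a ^ 2 + 4)) = (1 : ℤ[X]) := by
    have := congrArg (C : ℤ →+* ℤ[X]) hwu
    simpa using this
  simp only [derivative_add, derivative_sub, derivative_mul, derivative_C, derivative_X_pow,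
    derivative_one, map_natCast] at hC ⊢
  push_cast
  linear_combination hC

section

variable {K : Type*} [Field K] [CharZero K] {θ α : K} {a : ℤ}

lemma mem_adjoin_of_two_mul_mem_of_odd (hθ : aeval θ (X ^ 8 + C a * X ^ 4 - 1 : ℤ[X]) = 0)
    (hθint : IsIntegral ℤ θ)
    (hdvd : ∀ P : ℤ[X], aeval θ P = 0 → X ^ 8 + C a * X ^ 4 - 1 ∣ P) (ha : Odd a)
    (hα : IsIntegral ℤ α) (h : ((2 : ℕ) : K) * α ∈ Algebra.adjoin ℤ {θ}) :
    α ∈ Algebra.adjoin ℤ {θ} := by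
  obtain ⟨c, rfl⟩ := ha
  refine mem_adjoin_of_prime_mul_mem Nat.prime_two hθ hθint hdvd (e := 4) (H := X ^ 2 + X + 1)
    (R := -2 * X ^ 7 - 5 * X ^ 6 - 8 * X ^ 5 + (C c - 9) * X ^ 4 - 8 * X ^ 3 - 5 * X ^ 2
      - 2 * X - 1) (by norm_num) ?_ ?_ ?_ hα h
  · simp only [C_add, C_mul, map_ofNat, map_one, Nat.cast_ofNat]
    ring
  · rw [separable_def, derivative_map]
    refine isCoprime_map_of_eq_one_add (U := 0) (V := 1) (W := X) ?_
    simp only [derivative_add, derivative_X_pow, derivative_X, derivative_one, map_natCast]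
    push_cast
    ring
  · obtain ⟨d, rfl | rfl⟩ := Int.even_or_odd' c
    · refine isCoprime_map_of_eq_one_add (U := 1)
        (V := -((X ^ 3 + 1) * (X - 1) + (2 * C d + 1) * X * (X - 1) + 1))
        (W := C d * X + (-X ^ 7 - 3 * X ^ 6 - 4 * X ^ 5 - 5 * X ^ 4 - 4 * X ^ 3 - 3 * X ^ 2
          - X - 1)) ?_
      simp only [C_mul, map_ofNat, Nat.cast_ofNat]
      ring
    · refine isCoprime_map_of_eq_one_add (U := -X)
        (V := X * ((X ^ 3 + 1) * (X - 1) + (2 * C d + 2) * X * (X - 1) + 1) + 1)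
        (W := -X * (C d * X + (-X ^ 7 - 3 * X ^ 6 - 4 * X ^ 5 - 5 * X ^ 4 - 4 * X ^ 3
          - 3 * X ^ 2 - X - 1))) ?_
      simp only [C_add, C_mul, map_ofNat, map_one, Nat.cast_ofNat]
      ring

lemma mem_adjoin_of_two_mul_mem_of_mod_four_eq_two
    (hθ : aeval θ (X ^ 8 + C a * X ^ 4 - 1 : ℤ[X]) = 0) (hθint : IsIntegral ℤ θ)
    (hdvd : ∀ P : ℤ[X], aeval θ P = 0 → X ^ 8 + C a * X ^ 4 - 1 ∣ P) (ha : a % 4 = 2)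
    (hα : IsIntegral ℤ α) (h : ((2 : ℕ) : K) * α ∈ Algebra.adjoin ℤ {θ}) :
    α ∈ Algebra.adjoin ℤ {θ} := by
  obtain ⟨d, rfl⟩ : ∃ d, a = 4 * d + 2 := ⟨a / 4, by omega⟩
  refine mem_adjoin_of_prime_mul_mem Nat.prime_two hθ hθint hdvd (e := 8) (H := X - 1)
    (R := 1 + 2 * (2 * X ^ 7 - 7 * X ^ 6 + 14 * X ^ 5 + (C d - 17) * X ^ 4 + 14 * X ^ 3
      - 7 * X ^ 2 + 2 * X - 1)) (by norm_num) ?_ ?_ ?_ hα h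
  · simp only [C_add, C_mul, map_ofNat, Nat.cast_ofNat]
    ring
  · rw [separable_def, derivative_map]
    refine isCoprime_map_of_eq_one_add (U := 0) (V := 1) (W := 0) ?_
    simp
  · refine isCoprime_map_of_eq_one_add (U := 1) (V := 0)
      (W := 2 * X ^ 7 - 7 * X ^ 6 + 14 * X ^ 5 + (C d - 17) * X ^ 4 + 14 * X ^ 3
        - 7 * X ^ 2 + 2 * X - 1) ?_
    simp only [map_ofNat, Nat.cast_ofNat]
    ring

lemma mem_adjoin_of_odd_prime_mul_mem {p : ℕ} (hp : p.Prime) (hp2 : p ≠ 2)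
    (hθ : aeval θ (X ^ 8 + C a * X ^ 4 - 1 : ℤ[X]) = 0) (hθint : IsIntegral ℤ θ)
    (hdvd : ∀ P : ℤ[X], aeval θ P = 0 → X ^ 8 + C a * X ^ 4 - 1 ∣ P)
    (hpa : ¬ (p : ℤ) * p ∣ a ^ 2 + 4)
    (hα : IsIntegral ℤ α) (h : (p : K) * α ∈ Algebra.adjoin ℤ {θ}) :
    α ∈ Algebra.adjoin ℤ {θ} := by
  have hp' := Nat.prime_iff_prime_int.1 hp
  by_cases hpd : (p : ℤ) ∣ a ^ 2 + 4
  · obtain ⟨t, ht⟩ := hpd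
    obtain ⟨q, hq⟩ := hp.odd_of_ne_two hp2
    have hqp : (p : ℤ) = 2 * q + 1 := by exact_mod_cast hq
    have h2 : ¬ (p : ℤ) ∣ 2 := fun h =>
      hp2 ((Nat.prime_dvd_prime_iff_eq hp Nat.prime_two).1 (by exact_mod_cast h))
    have h4 : ¬ (p : ℤ) ∣ 4 := fun h => h2 (hp'.dvd_of_dvd_pow (n := 2) (by norm_num; exact h))
    -- `2 b ≡ a` modulo `p ^ 2`
    obtain ⟨b, hb⟩ : ∃ b : ℤ, 2 * b = a - a * p ^ 2 :=
      ⟨-a * (2 * q ^ 2 + 2 * q), by rw [hqp]; ring⟩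
    have hbt : 4 * (b ^ 2 + 1) = p * (t + p * (a ^ 2 * (p ^ 2 - 2))) := by
      linear_combination (2 * b + (a - a * p ^ 2)) * hb + ht
    obtain ⟨s, hs⟩ : (p : ℤ) ∣ b ^ 2 + 1 :=
      (hp'.dvd_or_dvd (Dvd.intro _ hbt.symm)).resolve_left h4
    have hs4 : 4 * s = t + p * (a ^ 2 * (p ^ 2 - 2)) := by
      refine mul_left_cancel₀ hp'.ne_zero ?_
      linear_combination hbt - 4 * hs
    have hps : ¬ (p : ℤ) ∣ s := by
      rintro ⟨r, rfl⟩
      refine hpa ⟨4 * r - a ^ 2 * (p ^ 2 - 2), ?_⟩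
      linear_combination ht - p * hs4
    have hpb : ¬ (p : ℤ) ∣ 4 * b := by
      intro hd
      obtain ⟨r, rfl⟩ := (hp'.dvd_or_dvd hd).resolve_left h4
      exact hp'.not_dvd_one ⟨s - p * r ^ 2, by linear_combination hs⟩
    obtain ⟨w, u, hwu⟩ := (Prime.coprime_iff_not_dvd hp').2 hps
    obtain ⟨w', u', hwu'⟩ := (Prime.coprime_iff_not_dvd hp').2 hpb
    refine mem_adjoin_of_prime_mul_mem hp hθ hθint hdvd (e := 2) (H := X ^ 4 + C b)
      (R := C (a * p) * X ^ 4 - C s) (by norm_num) ?_ ?_ ?_ hα h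
    · have hb' := congrArg (C : ℤ →+* ℤ[X]) hb
      have hs' := congrArg (C : ℤ →+* ℤ[X]) hs
      simp only [C_mul, C_add, C_sub, C_pow, C_1, map_ofNat, map_natCast] at hb' hs' ⊢
      linear_combination (-X ^ 4) * hb' - hs'
    · rw [separable_def, derivative_map]
      refine isCoprime_map_of_eq_one_add (U := 4 * C u') (V := -C u' * X) (W := -C w') ?_
      have hC := congrArg (C : ℤ →+* ℤ[X]) hwu'
      simp only [C_mul, C_add, C_1, map_ofNat, map_natCast, derivative_add, derivative_X_pow,
        derivative_C] at hC ⊢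
      push_cast
      linear_combination hC
    · refine isCoprime_map_of_eq_one_add (U := -C u) (V := 0)
        (W := -C w - C u * C a * X ^ 4) ?_
      have hC := congrArg (C : ℤ →+* ℤ[X]) hwu
      simp only [C_mul, C_add, C_1, map_natCast] at hC ⊢
      linear_combination hC
  · refine mem_adjoin_of_prime_mul_mem hp hθ hθint hdvd (e := 1) (R := 1)
      (H := X ^ 8 + C a * X ^ 4 - 1 - C (p : ℤ)) one_ne_zero (by ring) ?_ ?_ hα h
    · rw [Polynomial.map_sub]
      simpa using separable_map_of_not_dvd hp hp2 hpd
    · rw [Polynomial.map_one]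
      exact isCoprime_one_left

end

theorem stmt_12 (a : ℤ) (ha : a ≠ 0) (h4 : ¬ (4 ∣ a))
    (hsf : (Odd a ∧ Squarefree (a ^ 2 + 4)) ∨ (a % 4 = 2 ∧ Squarefree ((a ^ 2 + 4) / 8)))
    (hirr : Irreducible ((X ^ 8 + C a * X ^ 4 - 1 : Polynomial ℤ).map (Int.castRingHom ℚ))) :
    IsMonogenic (X ^ 8 + C a * X ^ 4 - 1) := by
  have hmonic : (X ^ 8 + C a * X ^ 4 - 1 : ℤ[X]).Monic := by monicity!
  refine ⟨hmonic, hirr, fun K _ _ θ hθ htop => ?_⟩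
  have hθint : IsIntegral ℤ θ := ⟨_, hmonic, hθ⟩
  have hmin : minpoly ℤ θ = X ^ 8 + C a * X ^ 4 - 1 := by
    have hirr' : Irreducible ((X ^ 8 + C a * X ^ 4 - 1 : ℤ[X]).map (algebraMap ℤ ℚ)) := hirr
    have := minpoly.eq_of_irreducible_of_monic hirr' (x := θ)
      (by rw [aeval_map_algebraMap, hθ]) (hmonic.map _)
    rw [minpoly.isIntegrallyClosed_eq_field_fractions' ℚ hθint] at this
    exact (map_injective _ (algebraMap ℤ ℚ).injective_int this).symm
  have hdvd (P : ℤ[X]) (hP : aeval θ P = 0) : X ^ 8 + C a * X ^ 4 - 1 ∣ P :=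
    hmin ▸ minpoly.isIntegrallyClosed_dvd hθint hP
  refine adjoin_eq_integralClosure_of_saturated hθint htop fun p hp α hα h => ?_
  rcases eq_or_ne p 2 with rfl | hp2
  · rcases hsf with ⟨hodd, -⟩ | ⟨hmod, -⟩
    · exact mem_adjoin_of_two_mul_mem_of_odd hθ hθint hdvd hodd hα h
    · exact mem_adjoin_of_two_mul_mem_of_mod_four_eq_two hθ hθint hdvd hmod hα h
  · refine mem_adjoin_of_odd_prime_mul_mem hp hp2 hθ hθint hdvd (fun hpp => ?_) hα h
    have hp' := Nat.prime_iff_prime_int.1 hp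
    rcases hsf with ⟨-, hsq⟩ | ⟨hmod, hsq⟩
    · exact hp'.not_isUnit (hsq _ hpp)
    · obtain ⟨d, rfl⟩ : ∃ d, a = 4 * d + 2 := ⟨a / 4, by omega⟩
      have h8 : (4 * d + 2) ^ 2 + 4 = 8 * (2 * d ^ 2 + 2 * d + 1) := by ring
      rw [h8] at hpp hsq
      rw [Int.mul_ediv_cancel_left _ (by norm_num)] at hsq
      have hcop : IsCoprime ((p : ℤ) * p) 8 := by
        have : IsCoprime (p : ℤ) 2 := (Prime.coprime_iff_not_dvd hp').2 fun h =>
          hp2 ((Nat.prime_dvd_prime_iff_eq hp Nat.prime_two).1 (by exact_mod_cast h))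
        exact (this.mul_left this).pow_right (n := 3)
      exact hp'.not_isUnit (hsq _ (hcop.dvd_of_dvd_mul_left hpp))
end

section
/- Let t ∈ ℤ with t ≠ 0. The polynomial F(x) = x⁸ + 2t·x⁴ + t² + 1 is monogenic if and only if the integer t² + 1 is squarefree. -/
open Polynomial

namespace Monogenic

theorem adjoin_sub_intCast_singleton (R : Type*) {A : Type*} [CommRing R] [CommRing A] [Algebra R A]
    (θ : A) (s : ℤ) :
    Algebra.adjoin R {θ - (s : A)} = Algebra.adjoin R {θ} := by
  apply le_antisymm <;> refine Algebra.adjoin_le (Set.singleton_subset_iff.2 ?_)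
  · exact sub_mem (Algebra.self_mem_adjoin_singleton R θ) (intCast_mem _ s)
  · have h := add_mem (Algebra.self_mem_adjoin_singleton R (θ - (s : A))) (intCast_mem _ s)
    rwa [sub_add_cancel] at h

section NumberField

variable {K : Type*} [Field K] [NumberField K] {θ : K}

/-- The different of `ℤ[θ]`, generated by `f'(θ)` for `f` the minimal polynomial of `θ`, lies in the
conductor of `ℤ[θ]`. -/
theorem aeval_derivative_minpoly_mul_mem_adjoin (hθ : IsIntegral ℤ θ)
    (htop : Algebra.adjoin ℚ {θ} = ⊤) {z : K} (hz : IsIntegral ℤ z) :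
    aeval θ (derivative (minpoly ℤ θ)) * z ∈ Algebra.adjoin ℤ {θ} := by
  let x : NumberField.RingOfIntegers K := ⟨θ, hθ⟩
  let y : NumberField.RingOfIntegers K := ⟨z, hz⟩
  have hmin : minpoly ℤ x = minpoly ℤ θ :=
    (minpoly.algebraMap_eq (B' := K) NumberField.RingOfIntegers.coe_injective x).symm
  have hmem : aeval x (derivative (minpoly ℤ x)) ∈ conductor ℤ x :=
    Ideal.mul_le_left (I := conductor ℤ x) (J := differentIdeal ℤ (NumberField.RingOfIntegers K))
      (by
        rw [conductor_mul_differentIdeal ℤ ℚ K x htop]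
        exact Ideal.mem_span_singleton_self _)
  let φ := IsScalarTower.toAlgHom ℤ (NumberField.RingOfIntegers K) K
  have h : φ _ ∈ (Algebra.adjoin ℤ {x}).map φ :=
    Subalgebra.mem_map.2 ⟨_, mem_conductor_iff.1 hmem y, rfl⟩
  rw [AlgHom.map_adjoin_singleton, hmin, map_mul, ← aeval_algHom_apply] at h
  exact h

/-- If `θ` has squarefree norm, then division by `θ` inside the ring of integers does not leave
`ℤ[θ]`. -/
theorem mem_adjoin_of_mul_mem_adjoin (hθ : IsIntegral ℤ θ) (htop : Algebra.adjoin ℚ {θ} = ⊤)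
    (hsq : Squarefree ((minpoly ℤ θ).coeff 0)) {z : K} (hz : IsIntegral ℤ z)
    (hmem : θ * z ∈ Algebra.adjoin ℤ {θ}) : z ∈ Algebra.adjoin ℤ {θ} := by
  have haeval (g : ℤ[X]) : aeval θ g = θ * aeval θ g.divX + (g.coeff 0 : K) := by
    conv_lhs => rw [← X_mul_divX_add g]
    simp
  have hadj (g : ℤ[X]) : aeval θ g ∈ Algebra.adjoin ℤ {θ} := aeval_mem_adjoin_singleton ℤ θ
  have hmin := haeval (minpoly ℤ θ)
  rw [minpoly.aeval] at hmin
  have hθ0 : θ ≠ 0 := by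
    rintro rfl
    apply hsq.ne_zero
    exact_mod_cast (by simpa using hmin.symm : (((minpoly ℤ (0 : K)).coeff 0 : ℤ) : K) = 0)
  obtain ⟨g, hg⟩ := (Algebra.adjoin_singleton_eq_range_aeval ℤ θ ▸ hmem)
  replace hg : aeval θ g = θ * z := hg
  rw [haeval] at hg
  set w := z - aeval θ g.divX with hw
  have hwint : IsIntegral ℤ w :=
    hz.sub (adjoin_le_integralClosure hθ (hadj _))
  have hθw : θ * w = (g.coeff 0 : K) := by rw [hw]; linear_combination -hg
  let B := PowerBasis.ofAdjoinEqTop (Algebra.IsIntegral.isIntegral (R := ℚ) θ) htop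
  have hBgen : B.gen = θ := PowerBasis.ofAdjoinEqTop_gen _ htop
  have hnorm : Algebra.norm ℚ θ = (-1) ^ B.dim * ((minpoly ℤ θ).coeff 0 : ℚ) := by
    conv_lhs => rw [← hBgen]
    rw [Algebra.PowerBasis.norm_gen_eq_coeff_zero_minpoly, hBgen,
      minpoly.isIntegrallyClosed_eq_field_fractions' ℚ hθ, coeff_map]
    rfl
  obtain ⟨N, hN⟩ := IsIntegrallyClosed.isIntegral_iff.1 (Algebra.isIntegral_norm ℚ hwint)
  have hprod : (minpoly ℤ θ).coeff 0 ∣ g.coeff 0 ^ Module.finrank ℚ K := by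
    refine ⟨(-1) ^ B.dim * N, ?_⟩
    have h := congrArg (Algebra.norm ℚ) hθw
    rw [map_mul, hnorm, ← hN, ← map_intCast (algebraMap ℚ K), Algebra.norm_algebraMap] at h
    simp only [algebraMap_int_eq, eq_intCast] at h
    have h' : (g.coeff 0 : ℚ) ^ Module.finrank ℚ K
      = (minpoly ℤ θ).coeff 0 * ((-1) ^ B.dim * N) := by linear_combination -h
    exact_mod_cast h'
  obtain ⟨k, hk⟩ := (hsq.dvd_pow_iff_dvd Module.finrank_pos.ne').1 hprod
  have hwk : w = -((k : K) * aeval θ (minpoly ℤ θ).divX) := by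
    apply mul_left_cancel₀ hθ0
    rw [hθw, hk]
    push_cast
    linear_combination -(k : K) * hmin
  have hzw : z = aeval θ (g.divX - C k * (minpoly ℤ θ).divX) := by
    have hz' : z = w + aeval θ g.divX := by rw [hw]; ring
    rw [hz', hwk]
    rw [map_sub, map_mul, aeval_C, algebraMap_int_eq, eq_intCast]
    ring
  rw [hzw]
  exact hadj _

/-- If the minimal polynomial of `θ` becomes Eisenstein at `p` after an integer translation, then
`ℤ[θ]` is maximal at `p`. -/
theorem mem_adjoin_of_prime_pow_smul_mem (hθ : IsIntegral ℤ θ)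
    (htop : Algebra.adjoin ℚ {θ} = ⊤) {p : ℤ} (hp : Prime p) (s : ℤ)
    (heis : (taylor s (minpoly ℤ θ)).IsEisensteinAt (Ideal.span {p})) {n : ℕ} {z : K}
    (hz : IsIntegral ℤ z) (hmem : p ^ n • z ∈ Algebra.adjoin ℤ {θ}) :
    z ∈ Algebra.adjoin ℤ {θ} := by
  have hint : IsIntegral ℤ (θ - (s : K)) := hθ.sub (isIntegral_algebraMap (x := s))
  rw [← adjoin_sub_intCast_singleton ℚ θ s] at htop
  rw [← adjoin_sub_intCast_singleton ℤ θ s] at hmem ⊢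
  let B := PowerBasis.ofAdjoinEqTop (Algebra.IsIntegral.isIntegral (R := ℚ) (θ - (s : K))) htop
  have hBgen : B.gen = θ - (s : K) := PowerBasis.ofAdjoinEqTop_gen _ htop
  have hmin : minpoly ℤ (θ - (s : K)) = taylor s (minpoly ℤ θ) := by
    apply Polynomial.map_injective _ (algebraMap ℤ ℚ).injective_int
    rw [← minpoly.isIntegrallyClosed_eq_field_fractions' ℚ hint, map_taylor,
      ← minpoly.isIntegrallyClosed_eq_field_fractions' ℚ hθ, taylor_apply,
      ← minpoly.sub_algebraMap]
    simp
  rw [← hBgen] at hint hmem hmin ⊢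
  exact mem_adjoin_of_smul_prime_pow_smul_of_minpoly_isEisensteinAt hp hint hz hmem (hmin ▸ heis)

end NumberField

/-- The polynomial `(x⁴ + t)² + 1`. -/
noncomputable def octic (t : ℤ) : ℤ[X] := X ^ 8 + C (2 * t) * X ^ 4 + C (t ^ 2 + 1)

variable (t : ℤ)

theorem natDegree_octic : (octic t).natDegree = 8 := by
  unfold octic; compute_degree!

theorem monic_octic : (octic t).Monic := by
  unfold octic; monicity!

theorem coeff_zero_octic : (octic t).coeff 0 = t ^ 2 + 1 := by
  simp [octic, coeff_zero_eq_eval_zero]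

theorem aeval_octic {A : Type*} [CommRing A] (θ : A) :
    aeval θ (octic t) = θ ^ 8 + 2 * t * θ ^ 4 + (t ^ 2 + 1) := by
  simp [octic, map_ofNat]

theorem isEisensteinAt_two_taylor_octic :
    ∃ s : ℤ, (taylor s (octic t)).IsEisensteinAt (Ideal.span {2}) := by
  obtain ⟨k, rfl | rfl⟩ := Int.even_or_odd' t
  · refine ⟨1, ?_, fun {n} hn ↦ ?_, ?_⟩
    · rw [leadingCoeff_taylor, monic_octic, Ideal.mem_span_singleton]
      decide
    · have h : taylor 1 (octic (2 * k)) = X ^ 8 + C 2 * (C 4 * X ^ 7 + C 14 * X ^ 6 + C 28 * X ^ 5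
          + C (35 + 2 * k) * X ^ 4 + C (28 + 8 * k) * X ^ 3 + C (14 + 12 * k) * X ^ 2
          + C (4 + 8 * k) * X + C (2 * k ^ 2 + 2 * k + 1)) := by
        simp only [octic, taylor_apply, add_comp, mul_comp, X_pow_comp, C_comp]
        simp only [map_add, map_mul, map_pow, map_ofNat, map_one]
        ring
      rw [natDegree_taylor, natDegree_octic] at hn
      rw [h, coeff_add, coeff_X_pow, if_neg hn.ne, zero_add, coeff_C_mul, Ideal.mem_span_singleton]
      exact dvd_mul_right _ _
    · rw [taylor_coeff_zero, Ideal.span_singleton_pow, Ideal.mem_span_singleton]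
      simp only [octic, eval_add, eval_mul, eval_pow, eval_X, eval_C]
      ring_nf
      omega
  · refine ⟨0, ?_, fun {n} hn ↦ ?_, ?_⟩
    · rw [leadingCoeff_taylor, monic_octic, Ideal.mem_span_singleton]
      decide
    · have h : octic (2 * k + 1) = X ^ 8 + C 2 * (C (2 * k + 1) * X ^ 4
          + C (2 * k ^ 2 + 2 * k + 1)) := by
        simp only [octic, map_add, map_mul, map_pow, map_ofNat, map_one]
        ring
      rw [natDegree_taylor, natDegree_octic] at hn
      rw [taylor_zero, h, coeff_add, coeff_X_pow, if_neg hn.ne, zero_add, coeff_C_mul,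
        Ideal.mem_span_singleton]
      exact dvd_mul_right _ _
    · rw [taylor_zero, coeff_zero_octic, Ideal.span_singleton_pow, Ideal.mem_span_singleton]
      ring_nf
      omega

theorem irreducible_octic : Irreducible (octic t) := by
  obtain ⟨s, hs⟩ := isEisensteinAt_two_taylor_octic t
  have hmonic : (taylor s (octic t)).Monic := by
    rw [Monic, leadingCoeff_taylor, monic_octic]
  have h := hs.irreducible ((Ideal.span_singleton_prime two_ne_zero).2 Int.prime_two)
    hmonic.isPrimitive (by rw [natDegree_taylor, natDegree_octic]; norm_num)
  exact (MulEquiv.irreducible_iff (taylorEquiv s)).1 h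

theorem irreducible_map_octic : Irreducible ((octic t).map (Int.castRingHom ℚ)) :=
  (monic_octic t).irreducible_iff_irreducible_map_fraction_map.1 (irreducible_octic t)

variable {t}

theorem isIntegral_of_aeval_octic {A : Type*} [CommRing A] {θ : A}
    (hroot : aeval θ (octic t) = 0) : IsIntegral ℤ θ :=
  ⟨octic t, monic_octic t, hroot⟩

section Root

variable {K : Type*} [Field K] [NumberField K] {θ : K}

theorem minpoly_eq_octic (hroot : aeval θ (octic t) = 0) : minpoly ℤ θ = octic t :=
  (eq_of_monic_of_associated (minpoly.monic (isIntegral_of_aeval_octic hroot)) (monic_octic t)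
    ((minpoly.irreducible (isIntegral_of_aeval_octic hroot)).associated_of_dvd
      (irreducible_octic t)
      (minpoly.isIntegrallyClosed_dvd (isIntegral_of_aeval_octic hroot) hroot)))

theorem adjoin_eq_integralClosure_of_squarefree (hsq : Squarefree (t ^ 2 + 1))
    (hroot : aeval θ (octic t) = 0) (htop : Algebra.adjoin ℚ {θ} = ⊤) :
    Algebra.adjoin ℤ {θ} = integralClosure ℤ K := by
  have hθ := isIntegral_of_aeval_octic hroot
  have hmin := minpoly_eq_octic hroot
  refine le_antisymm (adjoin_le_integralClosure hθ) fun z hz ↦ ?_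
  replace hz : IsIntegral ℤ z := hz
  have hself := Algebra.self_mem_adjoin_singleton ℤ θ
  have hderiv := aeval_derivative_minpoly_mul_mem_adjoin hθ htop hz
  -- `f'(θ) = 8θ³(θ⁴ + t)`, and `θ⁴ + t` is a unit with inverse `-(θ⁴ + t)`.
  have hcube : θ * (θ * (θ * ((2 : ℤ) ^ 3 • z))) ∈ Algebra.adjoin ℤ {θ} := by
    have h := mul_mem (neg_mem (add_mem (pow_mem hself 4) (intCast_mem _ t))) hderiv
    rw [hmin] at h
    convert h using 1
    rw [aeval_octic] at hroot
    have hd : derivative (octic t) = C 8 * X ^ 3 * (X ^ 4 + C t) := by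
      simp only [octic, derivative_add, derivative_mul, derivative_X_pow, derivative_C]
      simp only [map_mul, map_ofNat, Nat.cast_ofNat]
      ring
    simp only [hd, map_add, map_mul, map_pow, aeval_X, map_ofNat, map_intCast, zsmul_eq_mul,
      eq_intCast]
    push_cast
    linear_combination 8 * θ ^ 3 * z * hroot
  have hdiv {y : K} (hy : IsIntegral ℤ y) (hmem : θ * y ∈ Algebra.adjoin ℤ {θ}) :
      y ∈ Algebra.adjoin ℤ {θ} :=
    mem_adjoin_of_mul_mem_adjoin hθ htop (by rwa [hmin, coeff_zero_octic]) hy hmem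
  have h8 : IsIntegral ℤ ((2 : ℤ) ^ 3 • z) := hz.smul _
  obtain ⟨s, hs⟩ := isEisensteinAt_two_taylor_octic t
  exact mem_adjoin_of_prime_pow_smul_mem hθ htop Int.prime_two s (hmin ▸ hs) hz
    (hdiv h8 (hdiv (hθ.mul h8) (hdiv (hθ.mul (hθ.mul h8)) hcube)))

/-- If `p² ∣ t² + 1`, then `θ³(θ⁴ + 2t) / p` is integral but does not lie in `ℤ[θ]`. -/
theorem squarefree_of_adjoin_eq_integralClosure (hroot : aeval θ (octic t) = 0)
    (heq : Algebra.adjoin ℤ {θ} = integralClosure ℤ K) : Squarefree (t ^ 2 + 1) := by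
  have hθ := isIntegral_of_aeval_octic hroot
  rintro p ⟨c, hc⟩
  have hp0 : (p : K) ≠ 0 := by
    rintro h
    obtain rfl : p = 0 := by exact_mod_cast h
    nlinarith [sq_nonneg t]
  have hcK : ((t : K) ^ 2 + 1) = p * p * c := by exact_mod_cast congrArg (Int.cast (R := K)) hc
  have hroot' := hroot
  rw [aeval_octic, hcK] at hroot'
  have hint : IsIntegral ℤ (θ ^ 3 * (θ ^ 4 + 2 * t) / (p : K)) := by
    refine IsIntegral.of_pow two_pos ?_
    have hsq : (θ ^ 3 * (θ ^ 4 + 2 * t) / (p : K)) ^ 2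
        = aeval θ (-C c * X ^ 2 * (X ^ 4 + C (2 * t))) := by
      simp [map_ofNat]
      field_simp
      linear_combination θ ^ 2 * (θ ^ 4 + 2 * t) * hroot'
    rw [hsq]
    exact adjoin_le_integralClosure hθ (aeval_mem_adjoin_singleton ℤ θ)
  have hmem : θ ^ 3 * (θ ^ 4 + 2 * t) / (p : K) ∈ Algebra.adjoin ℤ {θ} := heq ▸ hint
  obtain ⟨g, hg⟩ := (Algebra.adjoin_singleton_eq_range_aeval ℤ θ ▸ hmem)
  replace hg : aeval θ g = θ ^ 3 * (θ ^ 4 + 2 * t) / (p : K) := hg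
  rw [eq_div_iff hp0] at hg
  have hdvd : octic t ∣ X ^ 7 + C (2 * t) * X ^ 3 - C p * g := by
    rw [← minpoly_eq_octic hroot]
    refine minpoly.isIntegrallyClosed_dvd hθ ?_
    simp [map_ofNat]
    linear_combination -hg
  by_contra hunit
  -- Modulo `p` a monic polynomial of degree `8` would divide one of degree `7`.
  let φ := Ideal.Quotient.mk (Ideal.span {p})
  have : Nontrivial (ℤ ⧸ Ideal.span {p}) :=
    Ideal.Quotient.nontrivial_iff.2 (by rwa [Ne, Ideal.span_singleton_eq_top])
  have hφp : φ p = 0 := Ideal.Quotient.eq_zero_iff_mem.2 (Ideal.mem_span_singleton_self p)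
  have hdvd' := Polynomial.map_dvd φ hdvd
  have hmap : (X ^ 7 + C (2 * t) * X ^ 3 - C p * g).map φ = X ^ 7 + C (φ (2 * t)) * X ^ 3 := by
    simp only [Polynomial.map_sub, Polynomial.map_add, Polynomial.map_mul, Polynomial.map_pow,
      map_X, map_C, hφp, C_0, zero_mul, sub_zero]
  rw [hmap] at hdvd'
  have hmonic : (X ^ 7 + C (φ (2 * t)) * X ^ 3).Monic := by monicity!
  have hdeg : (X ^ 7 + C (φ (2 * t)) * X ^ 3).natDegree = 7 := by compute_degree!
  refine ((monic_octic t).map φ).not_dvd_of_natDegree_lt hmonic.ne_zero ?_ hdvd'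
  rw [hdeg, (monic_octic t).natDegree_map, natDegree_octic]
  norm_num

end Root

end Monogenic

open Monogenic in
theorem stmt_14 (t : ℤ) (ht : t ≠ 0) :
    IsMonogenic (X ^ 8 + C (2 * t) * X ^ 4 + C (t ^ 2 + 1)) ↔ Squarefree (t ^ 2 + 1) := by
  change IsMonogenic (octic t) ↔ _
  refine ⟨fun ⟨_, _, h⟩ ↦ ?_, fun hsq ↦ ⟨monic_octic t, irreducible_map_octic t,
    fun K _ _ θ hroot htop ↦ adjoin_eq_integralClosure_of_squarefree hsq hroot htop⟩⟩
  let f := (octic t).map (Int.castRingHom ℚ)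
  have : Fact (Irreducible f) := ⟨irreducible_map_octic t⟩
  have : FiniteDimensional ℚ (AdjoinRoot f) :=
    (AdjoinRoot.powerBasis (irreducible_map_octic t).ne_zero).finite
  have : NumberField (AdjoinRoot f) := { to_charZero := inferInstance, to_finiteDimensional := this }
  have hroot : aeval (AdjoinRoot.root f) (octic t) = 0 := by
    have h := AdjoinRoot.aeval_eq (f := f) f
    rw [AdjoinRoot.mk_self] at h
    exact (aeval_map_algebraMap ℚ (AdjoinRoot.root f) (octic t)).symm.trans h
  exact squarefree_of_adjoin_eq_integralClosure hroot (h _ _ hroot AdjoinRoot.adjoinRoot_eq_top)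
end
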